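/- Let ℓ ≥ 1. For every maximal isotropic flag F in ℂ^{2ℓ+1} there exists a unique SO(2ℓ+1)-flag F′ in standard form such that F = g·F′ for some g ∈ B_{SO(2ℓ)}. Equivalently, the map sending an SO(2ℓ+1)-flag in standard form to its B_{SO(2ℓ)}-orbit is a bijection from the set of SO(2ℓ+1)-flags in standard form onto the set of B_{SO(2ℓ)}-orbits of maximal isotropic flags in ℂ^{2ℓ+1}. -/

import Mathlib

open scoped BigOperators

noncomputable section

/-- The symmetric bilinear form `β(x, y) = xᵀ S y` on `ℂⁿ`, where `S` is the permutation
matrix sending `eᵢ` to `e_{n+1-i}`. -/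
def bform (n : ℕ) (x y : Fin n → ℂ) : ℂ :=
  ∑ i : Fin n, x i * y (⟨n - 1 - (i : ℕ), by have := i.isLt; omega⟩ : Fin n)

/-- Membership in `SO(n) = {g ∈ SL(n, ℂ) : β(gx, gy) = β(x, y)}`. -/
def memSO (n : ℕ) (g : Matrix (Fin n) (Fin n) ℂ) : Prop :=
  g.det = 1 ∧ ∀ x y : Fin n → ℂ, bform n (g.mulVec x) (g.mulVec y) = bform n x y

/-- Membership in the subgroup `B_{SO(2ℓ)}` of `SO(2ℓ+1)`: upper triangular elements of
`SO(2ℓ+1)` fixing `e_{ℓ+1}` (0-indexed: index `ℓ`). -/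
def memBB (ℓ : ℕ) (g : Matrix (Fin (2 * ℓ + 1)) (Fin (2 * ℓ + 1)) ℂ) : Prop :=
  memSO (2 * ℓ + 1) g ∧
  (∀ i j : Fin (2 * ℓ + 1), (j : ℕ) < (i : ℕ) → g i j = 0) ∧
  g.mulVec (Pi.single (⟨ℓ, by omega⟩ : Fin (2 * ℓ + 1)) (1 : ℂ)) =
    Pi.single (⟨ℓ, by omega⟩ : Fin (2 * ℓ + 1)) (1 : ℂ)

/-- A maximal isotropic flag in `ℂ^{2ℓ+1}`: a chain `V₁ ⊂ ⋯ ⊂ V_ℓ` of isotropic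
subspaces with `dim Vᵢ = i`. -/
structure FlagB (ℓ : ℕ) where
  V : Fin ℓ → Submodule ℂ (Fin (2 * ℓ + 1) → ℂ)
  mono : ∀ i j, i ≤ j → V i ≤ V j
  dimV : ∀ i, Module.finrank ℂ (V i) = (i : ℕ) + 1
  isot : ∀ i, ∀ u ∈ V i, ∀ w ∈ V i, bform (2 * ℓ + 1) u w = 0

/-- Two maximal isotropic flags lie in the same `B_{SO(2ℓ)}`-orbit. -/
def flagBRel (ℓ : ℕ) (F F' : FlagB ℓ) : Prop :=
  ∃ g, memBB ℓ g ∧ ∀ i, (F'.V i).map (Matrix.toLin' g) = F.V i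

/-- The kinds of vectors occurring in an `SO(2ℓ+1)`-flag in standard form: standard basis
vectors (0-indexed by `Fin (2ℓ+1)`), hat vectors of the first kind
`êᵢ = eᵢ + √2 e₀ - e₋ᵢ` (for `1 ≤ i ≤ ℓ`) and hat vectors of the second kind
`ê_{i,-j} = êᵢ + e₋ⱼ` (for `1 ≤ j < i ≤ ℓ`). -/
inductive BKind (ℓ : ℕ) where
  | std (j : Fin (2 * ℓ + 1))
  | hat1 (i : ℕ)
  | hat2 (i j : ℕ)

/-- The vector in `ℂ^{2ℓ+1}` corresponding to a `BKind` (0-indexed: `eᵢ` is index `i - 1`,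
`e₀` is index `ℓ`, `e₋ⱼ` is index `2ℓ + 1 - j`). -/
def bvec (ℓ : ℕ) : BKind ℓ → (Fin (2 * ℓ + 1) → ℂ)
  | .std j => Pi.single j 1
  | .hat1 i =>
      if h : 1 ≤ i ∧ i ≤ ℓ then
        Pi.single (⟨i - 1, by omega⟩ : Fin (2 * ℓ + 1)) 1 +
          (Real.sqrt 2 : ℂ) • (Pi.single (⟨ℓ, by omega⟩ : Fin (2 * ℓ + 1)) 1 : Fin (2 * ℓ + 1) → ℂ) -
          Pi.single (⟨2 * ℓ + 1 - i, by omega⟩ : Fin (2 * ℓ + 1)) 1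
      else 0
  | .hat2 i j =>
      if h : 1 ≤ j ∧ j < i ∧ i ≤ ℓ then
        Pi.single (⟨i - 1, by omega⟩ : Fin (2 * ℓ + 1)) 1 +
          (Real.sqrt 2 : ℂ) • (Pi.single (⟨ℓ, by omega⟩ : Fin (2 * ℓ + 1)) 1 : Fin (2 * ℓ + 1) → ℂ) -
          Pi.single (⟨2 * ℓ + 1 - i, by omega⟩ : Fin (2 * ℓ + 1)) 1 +
          Pi.single (⟨2 * ℓ + 1 - j, by omega⟩ : Fin (2 * ℓ + 1)) 1
      else 0

/-- The index of a `BKind`: the index of `eᵢ`, `e₋ᵢ` and `êᵢ` is `i` (and the index of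
`e₀` is `0`), while the index of `ê_{i,-j}` is `j`. -/
def bIndex (ℓ : ℕ) : BKind ℓ → ℕ
  | .std j =>
      if (j : ℕ) < ℓ then (j : ℕ) + 1
      else if (j : ℕ) = ℓ then 0 else 2 * ℓ + 1 - (j : ℕ)
  | .hat1 i => i
  | .hat2 _ j => j

/-- A maximal isotropic flag in `ℂ^{2ℓ+1}` is an `SO(2ℓ+1)`-flag in standard form. -/
def IsStdFlagB (ℓ : ℕ) (F : FlagB ℓ) : Prop :=
  ∃ c : Fin ℓ → BKind ℓ,
    (∀ i, F.V i = Submodule.span ℂ {w | ∃ k, k ≤ i ∧ w = bvec ℓ (c k)}) ∧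
    (∀ (i : Fin ℓ) (a : ℕ), c i = BKind.hat1 a → 1 ≤ a ∧ a ≤ ℓ) ∧
    (∀ (i : Fin ℓ) (a j : ℕ), c i = BKind.hat2 a j → 1 ≤ j ∧ j < a ∧ a ≤ ℓ) ∧
    (∀ (i k : Fin ℓ) (a : ℕ), c i = BKind.hat1 a → i < k → ∃ j, c k = BKind.std j) ∧
    (∀ i k : Fin ℓ, i < k → ∀ a ji jk : ℕ,
      c i = BKind.hat2 a ji → c k = BKind.hat2 a jk → ji < jk) ∧
    (∀ t : ℕ, 1 ≤ t → t ≤ ℓ → ∃! i : Fin ℓ, bIndex ℓ (c i) = t)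

namespace StdB

/-- The standard basis vector. -/
abbrev E {ℓ : ℕ} (q : Fin (2 * ℓ + 1)) : Fin (2 * ℓ + 1) → ℂ := Pi.single q 1

/-- The middle index. -/
def mid (ℓ : ℕ) : Fin (2 * ℓ + 1) := ⟨ℓ, by omega⟩

lemma bform_eq {n : ℕ} (x y : Fin n → ℂ) : bform n x y = ∑ i, x i * y i.rev := by
  unfold bform
  refine Finset.sum_congr rfl fun i _ => ?_
  congr 2
  apply Fin.ext
  simp only [Fin.val_rev]
  omega

lemma rev_mid (ℓ : ℕ) : (mid ℓ).rev = mid ℓ := by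
  apply Fin.ext; simp only [Fin.val_rev, mid]; omega

lemma rev_ne {ℓ : ℕ} {p : Fin (2 * ℓ + 1)} (h : p ≠ mid ℓ) : p.rev ≠ p := by
  intro h'
  apply h
  have := congrArg Fin.val h'
  simp only [Fin.val_rev] at this
  apply Fin.ext; simp only [mid]; omega

lemma bform_comm {n : ℕ} (x y : Fin n → ℂ) : bform n x y = bform n y x := by
  rw [bform_eq, bform_eq]
  rw [← Equiv.sum_comp Fin.revPerm]
  refine Finset.sum_congr rfl fun i _ => ?_
  simp [mul_comm]

lemma bform_add_left {n : ℕ} (x y z : Fin n → ℂ) :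
    bform n (x + y) z = bform n x z + bform n y z := by
  simp [bform_eq, add_mul, Finset.sum_add_distrib]

lemma bform_smul_left {n : ℕ} (a : ℂ) (x z : Fin n → ℂ) :
    bform n (a • x) z = a * bform n x z := by
  simp [bform_eq, Finset.mul_sum, mul_assoc]

lemma bform_add_right {n : ℕ} (x y z : Fin n → ℂ) :
    bform n z (x + y) = bform n z x + bform n z y := by
  simp [bform_eq, mul_add, Finset.sum_add_distrib]

lemma bform_smul_right {n : ℕ} (a : ℂ) (x z : Fin n → ℂ) :
    bform n z (a • x) = a * bform n z x := by
  rw [bform_comm, bform_smul_left, bform_comm]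

lemma bform_sub_left {n : ℕ} (x y z : Fin n → ℂ) :
    bform n (x - y) z = bform n x z - bform n y z := by
  simp [bform_eq, sub_mul, Finset.sum_sub_distrib]

lemma bform_sub_right {n : ℕ} (x y z : Fin n → ℂ) :
    bform n z (x - y) = bform n z x - bform n z y := by
  simp [bform_eq, mul_sub, Finset.sum_sub_distrib]

lemma bform_E_left {ℓ : ℕ} (q : Fin (2 * ℓ + 1)) (x : Fin (2 * ℓ + 1) → ℂ) :
    bform (2 * ℓ + 1) (E q) x = x q.rev := by
  rw [bform_eq, Finset.sum_eq_single q]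
  · simp
  · intro b _ hb; simp [hb]
  · simp

lemma bform_E_right {ℓ : ℕ} (q : Fin (2 * ℓ + 1)) (x : Fin (2 * ℓ + 1) → ℂ) :
    bform (2 * ℓ + 1) x (E q) = x q.rev := by
  rw [bform_comm, bform_E_left]

/-- Linear-map version of membership in the Borel subgroup. -/
structure InB (ℓ : ℕ) (f : (Fin (2 * ℓ + 1) → ℂ) →ₗ[ℂ] (Fin (2 * ℓ + 1) → ℂ)) : Prop where
  iso : ∀ x y, bform (2 * ℓ + 1) (f x) (f y) = bform (2 * ℓ + 1) x y
  fix : f (E (mid ℓ)) = E (mid ℓ)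
  tri : ∀ q i, q < i → f (E q) i = 0

lemma expand {ℓ : ℕ} (x : Fin (2 * ℓ + 1) → ℂ) : x = ∑ q, x q • E q := by
  funext i
  simp [Finset.sum_apply, Pi.single_apply]

lemma map_expand {ℓ : ℕ} (f : (Fin (2 * ℓ + 1) → ℂ) →ₗ[ℂ] (Fin (2 * ℓ + 1) → ℂ))
    (x : Fin (2 * ℓ + 1) → ℂ) : f x = ∑ q, x q • f (E q) := by
  conv_lhs => rw [expand x]
  simp

lemma InB.upper {ℓ : ℕ} {f : (Fin (2 * ℓ + 1) → ℂ) →ₗ[ℂ] (Fin (2 * ℓ + 1) → ℂ)} (hf : InB ℓ f)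
    {x : Fin (2 * ℓ + 1) → ℂ} {p : Fin (2 * ℓ + 1)} (hx : ∀ q, p < q → x q = 0) :
    ∀ q, p < q → f x q = 0 := by
  intro q hq
  rw [map_expand, Finset.sum_apply]
  refine Finset.sum_eq_zero fun r _ => ?_
  by_cases h : p < r
  · simp [hx r h]
  · simp [hf.tri r q (lt_of_le_of_lt (not_lt.1 h) hq)]

lemma InB.one (ℓ : ℕ) : InB ℓ LinearMap.id :=
  ⟨fun _ _ => rfl, rfl, fun q i h => by simp [h.ne']⟩

lemma InB.comp {ℓ : ℕ} {f g : (Fin (2 * ℓ + 1) → ℂ) →ₗ[ℂ] (Fin (2 * ℓ + 1) → ℂ)}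
    (hf : InB ℓ f) (hg : InB ℓ g) : InB ℓ (f ∘ₗ g) :=
  ⟨fun x y => by simp [hf.iso, hg.iso], by
    rw [LinearMap.comp_apply, hg.fix, hf.fix], fun q i h => by
    rw [LinearMap.comp_apply]
    exact hf.upper (hg.tri q) i h⟩

lemma InB.mid_coord {ℓ : ℕ} {f : (Fin (2 * ℓ + 1) → ℂ) →ₗ[ℂ] (Fin (2 * ℓ + 1) → ℂ)}
    (hf : InB ℓ f) (x : Fin (2 * ℓ + 1) → ℂ) : f x (mid ℓ) = x (mid ℓ) := by
  have := hf.iso x (E (mid ℓ))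
  rwa [hf.fix, bform_E_right, bform_E_right, rev_mid] at this

lemma InB.inj {ℓ : ℕ} {f : (Fin (2 * ℓ + 1) → ℂ) →ₗ[ℂ] (Fin (2 * ℓ + 1) → ℂ)}
    (hf : InB ℓ f) : Function.Injective f := by
  rw [← LinearMap.ker_eq_bot, LinearMap.ker_eq_bot']
  intro x hx
  funext i
  have := hf.iso x (E i.rev)
  rw [hx, bform_E_right, Fin.rev_rev] at this
  rw [← this, bform_eq]; simp

lemma InB.diag {ℓ : ℕ} {f : (Fin (2 * ℓ + 1) → ℂ) →ₗ[ℂ] (Fin (2 * ℓ + 1) → ℂ)}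
    (hf : InB ℓ f) (q : Fin (2 * ℓ + 1)) : f (E q) q * f (E q.rev) q.rev = 1 := by
  have := hf.iso (E q) (E q.rev)
  rw [bform_E_left] at this
  simp only [Pi.single_eq_same] at this
  rw [← this, bform_eq, Finset.sum_eq_single q]
  · intro b _ hb
    rcases lt_or_gt_of_ne hb with h | h
    · rw [hf.tri q.rev b.rev (Fin.rev_lt_rev.2 h), mul_zero]
    · rw [hf.tri q b h, zero_mul]
  · simp

lemma InB.upper_iff {ℓ : ℕ} {f : (Fin (2 * ℓ + 1) → ℂ) →ₗ[ℂ] (Fin (2 * ℓ + 1) → ℂ)}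
    (hf : InB ℓ f) (x : Fin (2 * ℓ + 1) → ℂ) (p : Fin (2 * ℓ + 1)) :
    (∀ q, p < q → f x q = 0) ↔ (∀ q, p < q → x q = 0) := by
  refine ⟨fun h => ?_, hf.upper⟩
  by_contra hcon
  push Not at hcon
  obtain ⟨q0, hq0, hx0⟩ := hcon
  obtain ⟨r, hr, hmax⟩ := (Finset.univ.filter fun q => x q ≠ 0).exists_maximal ⟨q0, by simp [hx0]⟩
  have hr' : x r ≠ 0 := by simpa using hr
  have hgt : ∀ q, r < q → x q = 0 := by
    intro q hq
    by_contra hne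
    exact absurd (hmax (by simpa using hne : q ∈ _) hq.le) (not_le.2 hq)
  have hpr : p < r := by
    by_contra hle
    exact hx0 (hgt _ (lt_of_le_of_lt (not_lt.1 hle) hq0))
  have := h r hpr
  rw [map_expand, Finset.sum_apply, Finset.sum_eq_single r] at this
  · simp only [Pi.smul_apply, smul_eq_mul, mul_eq_zero, hr', false_or] at this
    have hd := hf.diag r
    rw [this] at hd; simp at hd
  · intro b _ hb
    rcases lt_or_gt_of_ne hb with h | h
    · simp [hf.tri b r h]
    · simp [hgt b h]
  · simp

lemma InB.toBB {ℓ : ℕ} {f : (Fin (2 * ℓ + 1) → ℂ) →ₗ[ℂ] (Fin (2 * ℓ + 1) → ℂ)}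
    (hf : InB ℓ f) : memBB ℓ (LinearMap.toMatrix' f) := by
  have hmv : ∀ x, (LinearMap.toMatrix' f).mulVec x = f x := fun x => by
    rw [← Matrix.toLin'_apply, Matrix.toLin'_toMatrix']
  have happ : ∀ i j, LinearMap.toMatrix' f i j = f (E j) i := fun i j => by
    rw [← hmv]; simp
  refine ⟨⟨?_, fun x y => by rw [hmv, hmv, hf.iso]⟩, fun i j h => by rw [happ, hf.tri j i h], ?_⟩
  · rw [Matrix.det_of_isUpperTriangular]
    · simp only [happ]
      refine Finset.prod_involution (fun a _ => a.rev) (fun a _ => hf.diag a) ?_ (by simp) (by simp)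
      intro a _ ha h
      by_cases hm : a = mid ℓ
      · subst hm; rw [hf.fix] at ha; simp at ha
      · exact rev_ne hm h
    · intro i j h
      rw [happ, hf.tri j i h]
  · rw [hmv]; exact hf.fix

lemma InB.of_memBB {ℓ : ℕ} {g} (hg : memBB ℓ g) : InB ℓ (Matrix.toLin' g) := by
  obtain ⟨⟨_, h1⟩, h2, h3⟩ := hg
  refine ⟨fun x y => by simp only [Matrix.toLin'_apply, h1], ?_, fun q i h => ?_⟩
  · rw [Matrix.toLin'_apply]; exact h3
  · rw [Matrix.toLin'_apply]; simp [h2 i q h]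

/-- Key lemma: an element of the Borel moving a basis vector to a given isotropic vector. -/
lemma exists_move {ℓ : ℕ} (p : Fin (2 * ℓ + 1)) (v : Fin (2 * ℓ + 1) → ℂ) (hp : p ≠ mid ℓ)
    (hm : v (mid ℓ) = 0) (hv : bform (2 * ℓ + 1) v v = 0) (hvp : v p ≠ 0)
    (hgt : ∀ q, p < q → v q = 0) :
    ∃ f, InB ℓ f ∧ f (E p) = v ∧ f (E p.rev) = (v p)⁻¹ • E p.rev ∧
      ∀ s, s ≠ p → s ≠ p.rev → v s.rev = 0 → f (E s) = E s := by
  let f : (Fin (2 * ℓ + 1) → ℂ) →ₗ[ℂ] (Fin (2 * ℓ + 1) → ℂ) :=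
    { toFun := fun y => y + y p • (v - E p) +
        ((v p)⁻¹ * (y p.rev + y p * v p.rev - bform (2 * ℓ + 1) y v)) • E p.rev
      map_add' := fun x y => by
        rw [bform_add_left]
        simp only [Pi.add_apply]
        module
      map_smul' := fun a x => by
        rw [bform_smul_left]
        simp only [Pi.smul_apply, smul_eq_mul, RingHom.id_apply]
        module }
  have hf : ∀ y, f y = y + y p • (v - E p) +
        ((v p)⁻¹ * (y p.rev + y p * v p.rev - bform (2 * ℓ + 1) y v)) • E p.rev := fun y => rfl
  have hpr := rev_ne hp
  have hpr' : p ≠ p.rev := hpr.symm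
  have e1 : f (E p) = v := by
    rw [hf, bform_E_left]
    simp [hpr]
  have e2 : f (E p.rev) = (v p)⁻¹ • E p.rev := by
    rw [hf, bform_E_left]
    simp only [Pi.single_eq_same, Fin.rev_rev, Pi.single_eq_of_ne hpr', zero_smul, zero_mul,
      add_zero, mul_sub, inv_mul_cancel₀ hvp, mul_one]
    module
  have e3 : ∀ s, s ≠ p → s ≠ p.rev →
      f (E s) = E s - ((v p)⁻¹ * v s.rev) • E p.rev := by
    intro s h1 h2
    rw [hf, bform_E_left]
    simp only [Pi.single_eq_of_ne h1.symm, Pi.single_eq_of_ne h2.symm, zero_smul, zero_mul]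
    module
  refine ⟨f, ⟨?_, ?_, ?_⟩, e1, e2, ?_⟩
  · intro x y
    rw [hf, hf]
    simp only [bform_add_left, bform_add_right, bform_smul_left, bform_smul_right,
      bform_sub_left, bform_sub_right, bform_E_left, bform_E_right, hv, Fin.rev_rev]
    rw [bform_comm v y]
    simp only [Pi.add_apply, Pi.smul_apply, Pi.sub_apply, smul_eq_mul, Pi.single_eq_same, Pi.single_eq_of_ne hpr,
      Pi.single_eq_of_ne hpr']
    field_simp
    ring
  · rw [e3 _ hp.symm]
    · rw [rev_mid, hm]; simp
    · intro h; apply hp; rw [← Fin.rev_rev p, ← h, rev_mid]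
  · intro q i hqi
    by_cases h1 : q = p
    · subst h1; rw [e1]; exact hgt i hqi
    by_cases h2 : q = p.rev
    · subst h2; rw [e2]; simp [hqi.ne']
    rw [e3 q h1 h2]
    by_cases h3 : p < q.rev
    · simp [hgt _ h3, hqi.ne']
    · have : p.rev ≤ q := by rw [← Fin.rev_le_rev, Fin.rev_rev]; exact not_lt.1 h3
      simp [hqi.ne', (lt_of_le_of_lt this hqi).ne']
  · intro s h1 h2 h3
    rw [e3 s h1 h2, h3]; simp

/-- The hat vectors: `P = A.rev` gives the first kind, `P > A.rev` the second kind. -/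
def hv {ℓ : ℕ} (A P : Fin (2 * ℓ + 1)) : Fin (2 * ℓ + 1) → ℂ :=
  E A + (Real.sqrt 2 : ℂ) • E (mid ℓ) - E A.rev + if P = A.rev then 0 else E P

open Classical in
/-- The vectors of a standard flag. -/
def svec {ℓ : ℕ} (τ : Fin ℓ → Fin (2 * ℓ + 1)) (H : Fin ℓ → Prop) (A : Fin (2 * ℓ + 1))
    (i : Fin ℓ) : Fin (2 * ℓ + 1) → ℂ :=
  if H i then hv A (τ i) else E (τ i)

/-- The combinatorial conditions for a standard flag. -/
structure Comb {ℓ : ℕ} (τ : Fin ℓ → Fin (2 * ℓ + 1)) (H : Fin ℓ → Prop)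
    (A : Fin (2 * ℓ + 1)) : Prop where
  A_lt : A < mid ℓ
  ne_mid : ∀ i, τ i ≠ mid ℓ
  inj : ∀ i j, (τ i = τ j ∨ τ i = (τ j).rev) → i = j
  ge : ∀ i, H i → A.rev ≤ τ i
  dec : ∀ i j, i < j → H i → H j → τ j < τ i
  last : ∀ i, H i → ∃ q, H q ∧ τ q = A.rev

lemma sqrt2_ne : (Real.sqrt 2 : ℂ) ≠ 0 := by
  norm_cast
  positivity

lemma sqrt2_mul : (Real.sqrt 2 : ℂ) * (Real.sqrt 2 : ℂ) = 2 := by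
  norm_cast
  rw [Real.mul_self_sqrt (by norm_num)]

lemma mid_lt_rev {ℓ : ℕ} {A : Fin (2 * ℓ + 1)} (h : A < mid ℓ) : mid ℓ < A.rev := by
  rw [← rev_mid, Fin.rev_lt_rev]; exact h

lemma hv_mid {ℓ : ℕ} {A P : Fin (2 * ℓ + 1)} (h : A < mid ℓ) (hP : P ≠ mid ℓ) :
    hv A P (mid ℓ) = Real.sqrt 2 := by
  have := mid_lt_rev h
  unfold hv
  split_ifs <;> simp [h.ne', this.ne, hP.symm]

lemma hv_revA {ℓ : ℕ} {A P : Fin (2 * ℓ + 1)} (h : A < mid ℓ) :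
    hv A P A.rev = -1 := by
  have h2 := mid_lt_rev h
  unfold hv
  split_ifs with hP
  · simp [h2.ne', (h.trans h2).ne']
  · simp [h2.ne', (h.trans h2).ne', Ne.symm hP]

lemma hv_of_ne {ℓ : ℕ} {A P s : Fin (2 * ℓ + 1)} (h1 : s ≠ A) (h2 : s ≠ A.rev)
    (h3 : s ≠ mid ℓ) (h4 : s ≠ P) : hv A P s = 0 := by
  unfold hv
  split_ifs with hP <;> simp [h1, h2, h3, h4]

lemma hv_self {ℓ : ℕ} {A P : Fin (2 * ℓ + 1)} (h1 : P ≠ A) (h2 : P ≠ A.rev)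
    (h3 : P ≠ mid ℓ) : hv A P P = 1 := by
  unfold hv
  rw [if_neg h2]; simp [h1, h2, h3]

lemma hv_gt {ℓ : ℕ} {A P s : Fin (2 * ℓ + 1)} (h : A < mid ℓ) (hP : A.rev ≤ P) (hs : P < s) :
    hv A P s = 0 := by
  have h2 := mid_lt_rev h
  have h3 := lt_of_le_of_lt hP hs
  exact hv_of_ne ((h.trans h2).trans h3).ne' h3.ne' (h2.trans h3).ne' hs.ne'

section
variable {ℓ : ℕ} {τ : Fin ℓ → Fin (2 * ℓ + 1)} {H : Fin ℓ → Prop} {A : Fin (2 * ℓ + 1)}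

open Classical in
/-- Sum of the coefficients over hat positions. -/
def hs (H : Fin ℓ → Prop) (x : Fin ℓ → ℂ) : ℂ := ∑ q, if H q then x q else 0

lemma Comb.ne_A (hc : Comb τ H A) {r} (hr : H r) (i) : τ i ≠ A := by
  obtain ⟨q, hq, hqA⟩ := hc.last r hr
  intro h
  have : i = q := hc.inj i q (Or.inr (by rw [h, hqA, Fin.rev_rev]))
  subst this
  rw [h] at hqA
  exact rev_ne hc.A_lt.ne hqA.symm

lemma Comb.coord_tau (hc : Comb τ H A) (x : Fin ℓ → ℂ) (i) (hi : ¬ H i ∨ τ i ≠ A.rev) :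
    (∑ q, x q • svec τ H A q) (τ i) = x i := by
  have key : ∀ r, H r → τ i ≠ A.rev := by
    intro r hr
    rcases hi with hi | hi
    · obtain ⟨q, hq, hqA⟩ := hc.last r hr
      intro h
      have : i = q := hc.inj i q (Or.inl (by rw [h, hqA]))
      exact hi (this ▸ hq)
    · exact hi
  rw [Finset.sum_apply, Finset.sum_eq_single i]
  · by_cases h : H i
    · simp [svec, h, hv_self (hc.ne_A h i) (key i h) (hc.ne_mid i)]
    · simp [svec, h]
  · intro q _ hq
    have hne : τ i ≠ τ q := fun h => hq (hc.inj i q (Or.inl h)).symm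
    by_cases h : H q
    · simp [svec, h, hv_of_ne (hc.ne_A h i) (key q h) (hc.ne_mid i) hne]
    · simp [svec, h, hne]
  · simp

lemma Comb.coord_mid (hc : Comb τ H A) (x : Fin ℓ → ℂ) :
    (∑ q, x q • svec τ H A q) (mid ℓ) = Real.sqrt 2 * hs H x := by
  rw [Finset.sum_apply, hs, Finset.mul_sum]
  refine Finset.sum_congr rfl fun q _ => ?_
  by_cases h : H q
  · simp [svec, h, hv_mid hc.A_lt (hc.ne_mid q), mul_comm]
  · simp [svec, h, (hc.ne_mid q).symm]

lemma Comb.coord_revA (hc : Comb τ H A) (x : Fin ℓ → ℂ) {r} (hr : H r) :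
    (∑ q, x q • svec τ H A q) A.rev = - hs H x := by
  rw [Finset.sum_apply, hs, ← Finset.sum_neg_distrib]
  refine Finset.sum_congr rfl fun q _ => ?_
  by_cases h : H q
  · simp [svec, h, hv_revA hc.A_lt]
  · obtain ⟨q', hq', hqA⟩ := hc.last r hr
    have : A.rev ≠ τ q := by
      intro h'
      have : q' = q := hc.inj q' q (Or.inl (by rw [hqA, h']))
      exact h (this ▸ hq')
    simp [svec, h, this]

lemma hs_ne_zero {x : Fin ℓ → ℂ} (h : hs H x ≠ 0) : ∃ q, H q ∧ x q ≠ 0 := by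
  obtain ⟨q, _, hq⟩ := Finset.exists_ne_zero_of_sum_ne_zero h
  by_cases hH : H q
  · exact ⟨q, hH, by simpa [hH] using hq⟩
  · simp [hH] at hq

lemma Comb.coef_zero (hc : Comb τ H A) (x : Fin ℓ → ℂ) (h : ∑ q, x q • svec τ H A q = 0) (i) :
    x i = 0 := by
  have h1 : ∀ i, (¬ H i ∨ τ i ≠ A.rev) → x i = 0 := by
    intro i hi
    rw [← hc.coord_tau x i hi, h]; rfl
  by_contra hx
  by_cases hi : ¬ H i ∨ τ i ≠ A.rev
  · exact hx (h1 i hi)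
  push Not at hi
  have h2 := hc.coord_mid x
  rw [h] at h2
  have h3 : hs H x = x i := by
    unfold hs
    rw [Finset.sum_eq_single i]
    · simp [hi.1]
    · intro b _ hb
      rw [h1 b (Or.inr fun h' => hb (hc.inj b i (Or.inl (by rw [h', hi.2]))))]
      simp
    · simp
  rw [h3] at h2
  simp [hx] at h2

lemma Comb.linInd (hc : Comb τ H A) : LinearIndependent ℂ (svec τ H A) :=
  Fintype.linearIndependent_iff.2 fun x h i => hc.coef_zero x h i

lemma mem_span_Iic {V : Type*} [AddCommGroup V] [Module ℂ V] (w : Fin ℓ → V) (i : Fin ℓ) (v : V) :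
    v ∈ Submodule.span ℂ (w '' {q | q ≤ i}) ↔
      ∃ x : Fin ℓ → ℂ, (∀ q, i < q → x q = 0) ∧ v = ∑ q, x q • w q := by
  constructor
  · intro h
    induction h using Submodule.span_induction with
    | mem v hv =>
      obtain ⟨q, hq, rfl⟩ := hv
      refine ⟨Pi.single q 1, fun r hr => ?_, ?_⟩
      · rw [Pi.single_eq_of_ne (lt_of_le_of_lt hq hr).ne']
      · simp [Pi.single_apply]
    | zero => exact ⟨0, by simp, by simp⟩
    | add v w _ _ hv hw =>
      obtain ⟨x, hx, rfl⟩ := hv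
      obtain ⟨y, hy, rfl⟩ := hw
      exact ⟨x + y, fun q hq => by simp [hx q hq, hy q hq], by
        simp [add_smul, Finset.sum_add_distrib]⟩
    | smul a v _ hv =>
      obtain ⟨x, hx, rfl⟩ := hv
      exact ⟨a • x, fun q hq => by simp [hx q hq], by
        simp [Finset.smul_sum, mul_smul]⟩
  · rintro ⟨x, hx, rfl⟩
    refine Submodule.sum_mem _ fun q _ => ?_
    by_cases h : q ≤ i
    · exact Submodule.smul_mem _ _ (Submodule.subset_span ⟨q, h, rfl⟩)
    · rw [hx q (not_le.1 h)]; simp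

/-- `F` is the standard flag given by the data. -/
structure SF (F : FlagB ℓ) (τ : Fin ℓ → Fin (2 * ℓ + 1)) (H : Fin ℓ → Prop)
    (A : Fin (2 * ℓ + 1)) : Prop where
  comb : Comb τ H A
  span : ∀ i, F.V i = Submodule.span ℂ (svec τ H A '' {q | q ≤ i})

/-- First invariant. -/
def invN (F : FlagB ℓ) (i : Fin ℓ) : Set (Fin (2 * ℓ + 1)) :=
  {p | ∃ v ∈ F.V i, v ≠ 0 ∧ (∀ q < i, v ∉ F.V q) ∧ v (mid ℓ) = 0 ∧ ∀ q, p < q → v q = 0}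

/-- Second invariant. -/
def invM (F : FlagB ℓ) (i : Fin ℓ) : Set (Fin (2 * ℓ + 1)) :=
  {p | ∃ v ∈ F.V i, v (mid ℓ) ≠ 0 ∧ ∀ q, p < q → v q = 0}

/-- Third invariant. -/
def invH (F : FlagB ℓ) (i : Fin ℓ) : Prop := ∀ v ∈ F.V i, v (mid ℓ) = 0

lemma mem_of_rel {F F' : FlagB ℓ} {f : (Fin (2 * ℓ + 1) → ℂ) →ₗ[ℂ] (Fin (2 * ℓ + 1) → ℂ)}
    (hf : InB ℓ f) (h : ∀ i, (F'.V i).map f = F.V i) (i) (v) : f v ∈ F.V i ↔ v ∈ F'.V i := by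
  rw [← h i, Submodule.mem_map]
  constructor
  · rintro ⟨y, hy, hyv⟩
    rwa [← hf.inj hyv]
  · intro hv; exact ⟨v, hv, rfl⟩

lemma invN_rel {F F' : FlagB ℓ} {f : (Fin (2 * ℓ + 1) → ℂ) →ₗ[ℂ] (Fin (2 * ℓ + 1) → ℂ)}
    (hf : InB ℓ f) (h : ∀ i, (F'.V i).map f = F.V i) (i) : invN F i = invN F' i := by
  ext p
  constructor
  · rintro ⟨v, hv, h0, h1, h2, h3⟩
    obtain ⟨y, hy, rfl⟩ : ∃ y ∈ F'.V i, f y = v := by rwa [← h i, Submodule.mem_map] at hv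
    refine ⟨y, hy, fun e => h0 (by rw [e, map_zero]), fun q hq hm => h1 q hq ?_, ?_, ?_⟩
    · rwa [mem_of_rel hf h]
    · rwa [hf.mid_coord] at h2
    · rwa [hf.upper_iff] at h3
  · rintro ⟨y, hy, h0, h1, h2, h3⟩
    refine ⟨f y, (mem_of_rel hf h i y).2 hy, fun e => h0 (hf.inj (by rw [e, map_zero])),
      fun q hq hm => h1 q hq ?_, ?_, ?_⟩
    · rwa [mem_of_rel hf h] at hm
    · rwa [hf.mid_coord]
    · rwa [hf.upper_iff]

lemma invM_rel {F F' : FlagB ℓ} {f : (Fin (2 * ℓ + 1) → ℂ) →ₗ[ℂ] (Fin (2 * ℓ + 1) → ℂ)}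
    (hf : InB ℓ f) (h : ∀ i, (F'.V i).map f = F.V i) (i) : invM F i = invM F' i := by
  ext p
  constructor
  · rintro ⟨v, hv, h2, h3⟩
    obtain ⟨y, hy, rfl⟩ : ∃ y ∈ F'.V i, f y = v := by rwa [← h i, Submodule.mem_map] at hv
    refine ⟨y, hy, ?_, ?_⟩
    · rwa [hf.mid_coord] at h2
    · rwa [hf.upper_iff] at h3
  · rintro ⟨y, hy, h2, h3⟩
    refine ⟨f y, (mem_of_rel hf h i y).2 hy, ?_, ?_⟩
    · rwa [hf.mid_coord]
    · rwa [hf.upper_iff]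

lemma invH_rel {F F' : FlagB ℓ} {f : (Fin (2 * ℓ + 1) → ℂ) →ₗ[ℂ] (Fin (2 * ℓ + 1) → ℂ)}
    (hf : InB ℓ f) (h : ∀ i, (F'.V i).map f = F.V i) (i) : invH F i ↔ invH F' i := by
  constructor
  · intro hh v hv
    rw [← hf.mid_coord v]
    exact hh _ ((mem_of_rel hf h i v).2 hv)
  · intro hh v hv
    obtain ⟨y, hy, rfl⟩ : ∃ y ∈ F'.V i, f y = v := by rwa [← h i, Submodule.mem_map] at hv
    rw [hf.mid_coord]
    exact hh _ hy

variable {F : FlagB ℓ}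

lemma SF.mem (h : SF F τ H A) (i) (v) : v ∈ F.V i ↔
    ∃ x : Fin ℓ → ℂ, (∀ q, i < q → x q = 0) ∧ v = ∑ q, x q • svec τ H A q := by
  rw [h.span, mem_span_Iic]

lemma SF.svec_mem (h : SF F τ H A) {q i} (hq : q ≤ i) : svec τ H A q ∈ F.V i := by
  rw [h.span]; exact Submodule.subset_span ⟨q, hq, rfl⟩

lemma SF.not_mem (h : SF F τ H A) (x : Fin ℓ → ℂ) {i q} (hq : q < i) (hx : x i ≠ 0) :
    ∑ q, x q • svec τ H A q ∉ F.V q := by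
  intro hm
  rw [h.mem] at hm
  obtain ⟨y, hy, he⟩ := hm
  have := h.comb.coef_zero (x - y) (by
    simp only [Pi.sub_apply, sub_smul, Finset.sum_sub_distrib, he, sub_self]) i
  rw [Pi.sub_apply, hy i hq, sub_zero] at this
  exact hx this

lemma SF.coef_ne (h : SF F τ H A) (x : Fin ℓ → ℂ) {i : Fin ℓ} (hx : ∀ q, i < q → x q = 0)
    (h0 : ∑ q, x q • svec τ H A q ≠ 0) (h1 : ∀ q < i, ∑ q, x q • svec τ H A q ∉ F.V q) :
    x i ≠ 0 := by
  intro hi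
  by_cases hz : (i : ℕ) = 0
  · apply h0
    refine Finset.sum_eq_zero fun q _ => ?_
    rcases eq_or_ne q i with rfl | hq
    · simp [hi]
    · rw [hx q (by rw [Fin.lt_def]; have : (q : ℕ) ≠ i := fun h => hq (Fin.ext h); omega)]; simp
  · refine h1 ⟨i - 1, by omega⟩ (by rw [Fin.lt_def]; simp; omega) ?_
    rw [h.mem]
    refine ⟨x, fun q hq => ?_, rfl⟩
    rcases eq_or_ne q i with rfl | hq'
    · exact hi
    · refine hx q ?_
      have : (q : ℕ) ≠ i := fun h => hq' (Fin.ext h)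
      rw [Fin.lt_def] at hq ⊢
      simp at hq
      omega

lemma SF.invH_iff (h : SF F τ H A) (i) : invH F i ↔ ∀ q ≤ i, ¬ H q := by
  constructor
  · intro hh q hq hH
    have := hh _ (h.svec_mem hq)
    rw [svec, if_pos hH, hv_mid h.comb.A_lt (h.comb.ne_mid q)] at this
    exact sqrt2_ne this
  · intro hh v hv
    obtain ⟨x, hx, rfl⟩ := (h.mem i v).1 hv
    rw [h.comb.coord_mid]
    by_contra hne
    obtain ⟨q, hq, hxq⟩ := hs_ne_zero (right_ne_zero_of_mul hne)
    exact hxq (hx q (not_le.1 fun hle => hh q hle hq))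

lemma SF.leastN (h : SF F τ H A) {i} (hi : ¬ H i) : IsLeast (invN F i) (τ i) := by
  constructor
  · have e : svec τ H A i = ∑ q, (Pi.single i (1 : ℂ) : Fin ℓ → ℂ) q • svec τ H A q := by
      simp [Pi.single_apply]
    have e' : svec τ H A i = E (τ i) := by simp [svec, hi]
    refine ⟨svec τ H A i, h.svec_mem le_rfl, h.comb.linInd.ne_zero i, ?_, ?_, ?_⟩
    · intro q hq
      rw [e]
      exact h.not_mem _ hq (by simp)
    · rw [e']; simp [(h.comb.ne_mid i).symm]
    · intro q hq; rw [e']; simp [hq.ne']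
  · rintro p ⟨v, hv, h0, h1, h2, h3⟩
    obtain ⟨x, hx, rfl⟩ := (h.mem i v).1 hv
    have hxi := h.coef_ne x hx h0 h1
    by_contra hlt
    have := h3 _ (not_le.1 hlt)
    rw [h.comb.coord_tau x i (Or.inl hi)] at this
    exact hxi this

lemma SF.leastN' (h : SF F τ H A) {i q} (hi : H i) (hq : H q) (hqi : q < i)
    (hmax : ∀ r, H r → r < i → r ≤ q) : IsLeast (invN F i) (τ q) := by
  have hdec := h.comb.dec q i hqi hq hi
  have hA2 := mid_lt_rev h.comb.A_lt
  have hge := h.comb.ge i hi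
  constructor
  · have e : svec τ H A q - svec τ H A i =
        ∑ r, (Pi.single q (1 : ℂ) - Pi.single i (1 : ℂ) : Fin ℓ → ℂ) r • svec τ H A r := by
      simp [Pi.single_apply, sub_smul, Finset.sum_sub_distrib]
    refine ⟨svec τ H A q - svec τ H A i,
      Submodule.sub_mem _ (h.svec_mem hqi.le) (h.svec_mem le_rfl), ?_, ?_, ?_, ?_⟩
    · rw [sub_ne_zero]
      exact fun h' => hqi.ne (h.comb.linInd.injective h')
    · intro r hr
      rw [e]
      exact h.not_mem _ hr (by simp [hqi.ne'])
    · simp [svec, hi, hq, hv_mid h.comb.A_lt (h.comb.ne_mid _)]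
    · intro r hr
      simp [svec, hi, hq, hv_gt h.comb.A_lt hge (hdec.trans hr),
        hv_gt h.comb.A_lt (hge.trans hdec.le) hr]
  · rintro p ⟨v, hv, h0, h1, h2, h3⟩
    obtain ⟨x, hx, rfl⟩ := (h.mem i v).1 hv
    have hxi := h.coef_ne x hx h0 h1
    rw [h.comb.coord_mid] at h2
    have h2' : hs H x = 0 := by simpa [sqrt2_ne] using h2
    have h4 : ∃ r, H r ∧ r ≠ i ∧ x r ≠ 0 := by
      by_contra hcon
      push Not at hcon
      apply hxi
      rw [← h2', hs, Finset.sum_eq_single i]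
      · simp [hi]
      · intro b _ hb
        by_cases hbH : H b
        · simp [hcon b hbH hb]
        · simp [hbH]
      · simp
    obtain ⟨r, hr, hri, hxr⟩ := h4
    have hri' : r < i := lt_of_le_of_ne (not_lt.1 fun h' => hxr (hx r h')) hri
    have hrq := hmax r hr hri'
    have hτ : τ q ≤ τ r := by
      rcases eq_or_lt_of_le hrq with e | e
      · rw [e]
      · exact (h.comb.dec r q e hr hq).le
    refine hτ.trans ?_
    by_contra hlt
    have := h3 _ (not_le.1 hlt)
    rw [h.comb.coord_tau x r (Or.inr (lt_of_le_of_lt hge (hdec.trans_le hτ)).ne')] at this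
    exact hxr this

lemma SF.leastM (h : SF F τ H A) {i q} (hq : H q) (hqi : q ≤ i)
    (hmax : ∀ r, H r → r ≤ i → r ≤ q) : IsLeast (invM F i) (τ q) := by
  have hge := h.comb.ge q hq
  constructor
  · refine ⟨svec τ H A q, h.svec_mem hqi, ?_, fun r hr => ?_⟩
    · simp [svec, hq, hv_mid h.comb.A_lt (h.comb.ne_mid _)]
    · simp [svec, hq, hv_gt h.comb.A_lt hge hr]
  · rintro p ⟨v, hv, h2, h3⟩
    obtain ⟨x, hx, rfl⟩ := (h.mem i v).1 hv
    rw [h.comb.coord_mid] at h2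
    have h2' := right_ne_zero_of_mul h2
    obtain ⟨r, hr, hxr⟩ := hs_ne_zero h2'
    have hri : r ≤ i := not_lt.1 fun h' => hxr (hx r h')
    have hrq := hmax r hr hri
    have hτ : τ q ≤ τ r := by
      rcases eq_or_lt_of_le hrq with e | e
      · rw [e]
      · exact (h.comb.dec r q e hr hq).le
    refine hτ.trans ?_
    by_contra hlt
    have := h3 _ (not_le.1 hlt)
    by_cases hrA : τ r = A.rev
    · rw [hrA, h.comb.coord_revA x hr] at this
      exact h2' (by simpa using this)
    · rw [h.comb.coord_tau x r (Or.inr hrA)] at this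
      exact hxr this

lemma exists_last {H : Fin ℓ → Prop} (P : Fin ℓ → Prop) (h : ∃ r, H r ∧ P r) :
    ∃ q, H q ∧ P q ∧ ∀ r, H r → P r → r ≤ q := by
  classical
  obtain ⟨r, hr⟩ := h
  obtain ⟨q, hq, hmax⟩ := (Finset.univ.filter fun q => H q ∧ P q).exists_maximal ⟨r, by simp [hr]⟩
  simp only [Finset.mem_filter, Finset.mem_univ, true_and] at hq hmax
  exact ⟨q, hq.1, hq.2, fun r h1 h2 => (le_total r q).elim id (hmax ⟨h1, h2⟩)⟩

lemma SF.H_imp {F' : FlagB ℓ} {τ' : Fin ℓ → Fin (2 * ℓ + 1)} {H' : Fin ℓ → Prop}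
    {A' : Fin (2 * ℓ + 1)} (h : SF F τ H A) (h' : SF F' τ' H' A')
    (hN : ∀ i, invN F i = invN F' i) (hM : ∀ i, invM F i = invM F' i)
    (hH : ∀ i, invH F i ↔ invH F' i) (i) (hi : H i) : H' i := by
  by_contra hi'
  have h1 : ¬ invH F i := by
    rw [h.invH_iff]; push Not; exact ⟨i, le_rfl, hi⟩
  have h2 := h1
  rw [hH, h'.invH_iff] at h2
  push Not at h2
  obtain ⟨q', hq', hqi', hmax'⟩ := exists_last (H := H') (fun r => r ≤ i)
    (by obtain ⟨r, h1, h2⟩ := h2; exact ⟨r, h2, h1⟩)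
  have hlt' : q' < i := lt_of_le_of_ne hqi' (fun e => hi' (e ▸ hq'))
  let j : Fin ℓ := ⟨i - 1, by omega⟩
  have hj : ∀ r : Fin ℓ, r ≤ j ↔ r < i := by
    intro r
    have := Fin.lt_def.1 hlt'
    rw [Fin.lt_def, Fin.le_def]; simp only [j]; omega
  have h3 : ¬ invH F j := by
    rw [hH, h'.invH_iff]; push Not; exact ⟨q', (hj _).2 hlt', hq'⟩
  rw [h.invH_iff] at h3
  push Not at h3
  obtain ⟨q, hq, hqi, hmax⟩ := exists_last (H := H) (fun r => r < i)
    (by obtain ⟨r, h1, h2⟩ := h3; exact ⟨r, h2, (hj _).1 h1⟩)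
  have a1 := h.leastM (i := j) hq ((hj _).2 hqi) (fun r hr hri => hmax r hr ((hj _).1 hri))
  have a2 := h'.leastM (i := j) hq' ((hj _).2 hlt')
    (fun r hr hri => hmax' r hr ((hj _).1 hri).le)
  have a3 := h.leastN' hi hq hqi hmax
  have a4 := h'.leastN hi'
  rw [hM] at a1
  rw [hN] at a3
  have e1 := a1.unique a2
  have e2 := a3.unique a4
  have := h'.comb.inj i q' (Or.inl (by rw [← e2, e1]))
  exact hlt'.ne' this

lemma SF.unique {F' : FlagB ℓ} {τ' : Fin ℓ → Fin (2 * ℓ + 1)} {H' : Fin ℓ → Prop}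
    {A' : Fin (2 * ℓ + 1)} (h : SF F τ H A) (h' : SF F' τ' H' A')
    (hN : ∀ i, invN F i = invN F' i) (hM : ∀ i, invM F i = invM F' i)
    (hH : ∀ i, invH F i ↔ invH F' i) : F = F' := by
  have eH : H = H' := by
    funext i
    exact propext ⟨h.H_imp h' hN hM hH i,
      h'.H_imp h (fun i => (hN i).symm) (fun i => (hM i).symm) (fun i => (hH i).symm) i⟩
  subst eH
  have eτ : τ = τ' := by
    funext i
    by_cases hi : H i
    · have a1 := h.leastM (i := i) hi le_rfl (fun _ _ h => h)
      have a2 := h'.leastM (i := i) hi le_rfl (fun _ _ h => h)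
      rw [hM] at a1
      exact a1.unique a2
    · have a1 := h.leastN hi
      rw [hN] at a1
      exact a1.unique (h'.leastN hi)
  subst eτ
  have eV : ∀ i, F.V i = F'.V i := by
    by_cases hex : ∃ i, H i
    · obtain ⟨i, hi⟩ := hex
      have eA : A = A' := by
        obtain ⟨q, hq, e1⟩ := h.comb.last i hi
        obtain ⟨q', hq', e2⟩ := h'.comb.last i hi
        have l1 := h.comb.ge q' hq'
        have l2 := h'.comb.ge q hq
        rw [e2] at l1; rw [e1] at l2
        exact Fin.rev_injective (le_antisymm l1 l2)
      subst eA
      intro i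
      rw [h.span, h'.span]
    · push Not at hex
      have : svec τ H A = svec τ H A' := by
        funext i; simp [svec, hex i]
      intro i
      rw [h.span, h'.span, this]
  cases F; cases F'
  congr
  funext i
  exact eV i

end

section
variable {ℓ : ℕ}

/-- The kind of a hat vector. -/
def kind (A P : Fin (2 * ℓ + 1)) : BKind ℓ :=
  if P = A.rev then .hat1 (A + 1) else .hat2 (A + 1) (2 * ℓ + 1 - P)

/-- The absolute value of an index. -/
def fold (s : Fin (2 * ℓ + 1)) : ℕ := bIndex ℓ (.std s)

lemma fold_eq_iff {s t : Fin (2 * ℓ + 1)} : fold s = fold t ↔ (s = t ∨ s = t.rev) := by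
  have h1 := s.isLt
  have h2 := t.isLt
  have h3 : (t.rev : ℕ) + t = 2 * ℓ := by rw [Fin.val_rev]; omega
  simp only [fold, bIndex, Fin.ext_iff]
  generalize (t.rev : ℕ) = r at *
  generalize (t : ℕ) = t at *
  generalize (s : ℕ) = s at *
  split_ifs <;> constructor <;> intro h <;> first | omega | exact h.elim

lemma fold_le (s : Fin (2 * ℓ + 1)) : fold s ≤ ℓ := by
  simp only [fold, bIndex]
  split_ifs <;> omega

lemma fold_pos {s : Fin (2 * ℓ + 1)} : 1 ≤ fold s ↔ s ≠ mid ℓ := by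
  simp only [fold, bIndex, Ne, Fin.ext_iff, mid]
  split_ifs <;> omega

lemma bvec_kind {A P : Fin (2 * ℓ + 1)} (hA : A < mid ℓ) (hP : A.rev ≤ P) :
    bvec ℓ (kind A P) = hv A P := by
  unfold kind hv
  have hA' : (A : ℕ) < ℓ := hA
  rw [Fin.le_def, Fin.val_rev] at hP
  split_ifs with h
  · simp only [bvec]
    rw [dif_pos (by omega)]
    simp only [add_zero]
    congr 2
  · simp only [bvec]
    have h' : (P : ℕ) ≠ 2 * ℓ + 1 - (A + 1) := fun e => h (Fin.ext (by rw [Fin.val_rev]; exact e))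
    rw [dif_pos (by omega)]
    have e : (⟨2 * ℓ + 1 - (2 * ℓ + 1 - (P : ℕ)), by omega⟩ : Fin (2 * ℓ + 1)) = P :=
      Fin.ext (by simp only; omega)
    rw [e]
    rfl

lemma bIndex_kind {A P : Fin (2 * ℓ + 1)} (hA : A < mid ℓ) (hP : A.rev ≤ P) :
    bIndex ℓ (kind A P) = fold P := by
  unfold kind fold
  have hA' : (A : ℕ) < ℓ := hA
  rw [Fin.le_def, Fin.val_rev] at hP
  split_ifs with h
  · rw [h]; simp only [bIndex, Fin.val_rev]; split_ifs <;> omega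
  · simp only [bIndex]; split_ifs <;> omega

lemma hv_low {A P s : Fin (2 * ℓ + 1)} (hA : A < mid ℓ) (hP : A.rev ≤ P) (hs : s < mid ℓ) :
    hv A P s = if s = A then 1 else 0 := by
  have h2 := mid_lt_rev hA
  have h3 := h2.trans_le hP
  unfold hv
  split_ifs with h1 h4 h4
  · subst h4; simp [hs.ne, (hs.trans h2).ne]
  · simp [hs.ne, (hs.trans h2).ne, h4]
  · subst h4; simp [hs.ne, (hs.trans h2).ne, (hs.trans h3).ne]
  · simp [hs.ne, (hs.trans h2).ne, (hs.trans h3).ne, h4]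

lemma hv_high {A P s : Fin (2 * ℓ + 1)} (hA : A < mid ℓ) (hs : mid ℓ < s)
    (h : s ≠ A.rev) : hv A P s = if s = P then 1 else 0 := by
  split_ifs with h1
  · subst h1
    exact hv_self (hA.trans hs).ne' h hs.ne'
  · exact hv_of_ne (hA.trans hs).ne' h hs.ne' h1

lemma bform_hv {A P : Fin (2 * ℓ + 1)} (y : Fin (2 * ℓ + 1) → ℂ) :
    bform (2 * ℓ + 1) (hv A P) y = y A.rev + Real.sqrt 2 * y (mid ℓ) - y A +
      if P = A.rev then 0 else y P.rev := by
  unfold hv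
  rw [bform_add_left, bform_sub_left, bform_add_left, bform_smul_left, bform_E_left, bform_E_left,
    bform_E_left, rev_mid, Fin.rev_rev]
  split_ifs
  · rw [bform_eq]; simp
  · rw [bform_E_left]

lemma hv_pair {A P A' P' : Fin (2 * ℓ + 1)} (hA : A < mid ℓ) (hP : A.rev ≤ P)
    (hA' : A' < mid ℓ) (hP' : A'.rev ≤ P')
    (h : bform (2 * ℓ + 1) (hv A P) (hv A' P') = 0) : A = A' := by
  by_contra hne
  have h3 : mid ℓ < P := (mid_lt_rev hA).trans_le hP
  have h4 : P.rev < mid ℓ := by rw [← rev_mid, Fin.rev_lt_rev]; exact h3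
  have h3' : mid ℓ < P' := (mid_lt_rev hA').trans_le hP'
  rw [bform_hv, hv_mid hA' h3'.ne', sqrt2_mul, hv_low hA' hP' hA, hv_low hA' hP' h4,
    hv_high hA' (mid_lt_rev hA) (fun e => hne (Fin.rev_injective e)), if_neg hne] at h
  split_ifs at h <;> norm_num at h

lemma bform_hv_E {A P : Fin (2 * ℓ + 1)} (hA : A < mid ℓ) (hP : A.rev ≤ P)
    {s : Fin (2 * ℓ + 1)} (hs : s = A ∨ s = A.rev) :
    bform (2 * ℓ + 1) (hv A P) (E s) ≠ 0 := by
  rw [bform_E_right]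
  rcases hs with rfl | rfl
  · rw [hv_revA hA]; simp
  · rw [Fin.rev_rev, hv_low hA hP hA]; simp

lemma kind_ne_std (A P s : Fin (2 * ℓ + 1)) : kind A P ≠ .std s := by
  unfold kind; split_ifs <;> simp

lemma bij_of_unique (idx : Fin ℓ → ℕ)
    (h : ∀ t : ℕ, 1 ≤ t → t ≤ ℓ → ∃! i : Fin ℓ, idx i = t) :
    (∀ i, 1 ≤ idx i) ∧ Function.Injective idx := by
  have h' : ∀ t : Fin ℓ, ∃ i, idx i = t + 1 := fun t => (h (t + 1) (by omega) (by omega)).exists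
  choose u hu using h'
  have hinj : Function.Injective u := by
    intro a b e
    have := hu a
    rw [e, hu b] at this
    exact Fin.ext (by omega)
  have hsurj := Finite.surjective_of_injective hinj
  constructor
  · intro i
    obtain ⟨t, rfl⟩ := hsurj i
    rw [hu]; omega
  · intro i j e
    obtain ⟨t, rfl⟩ := hsurj i
    exact (h (t + 1) (by omega) (by omega)).unique (hu t) (by rw [← e, hu])

lemma exists_of_inj (idx : Fin ℓ → ℕ) (h1 : ∀ i, 1 ≤ idx i) (h2 : ∀ i, idx i ≤ ℓ)
    (hinj : Function.Injective idx) (t : ℕ) (ht : 1 ≤ t) (ht' : t ≤ ℓ) :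
    ∃! i : Fin ℓ, idx i = t := by
  let u : Fin ℓ → Fin ℓ := fun i => ⟨idx i - 1, by have := h1 i; have := h2 i; omega⟩
  have hu : Function.Injective u := by
    intro a b e
    apply hinj
    have := congrArg Fin.val e
    simp only [u] at this
    have := h1 a; have := h1 b
    omega
  obtain ⟨i, hi⟩ := Finite.surjective_of_injective hu ⟨t - 1, by omega⟩
  have := congrArg Fin.val hi
  simp only [u] at this
  have h3 := h1 i
  have e : idx i = t := by omega
  exact ⟨i, e, fun j hj => hinj (hj.trans e.symm)⟩

lemma setOf_eq_image {V : Type*} (w : Fin ℓ → V) (i : Fin ℓ) :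
    {v | ∃ k, k ≤ i ∧ v = w k} = w '' {q | q ≤ i} := by
  ext v
  constructor
  · rintro ⟨k, hk, rfl⟩; exact ⟨k, hk, rfl⟩
  · rintro ⟨k, hk, rfl⟩; exact ⟨k, hk, rfl⟩

lemma SF.isStd {F : FlagB ℓ} {τ : Fin ℓ → Fin (2 * ℓ + 1)} {H : Fin ℓ → Prop}
    {A : Fin (2 * ℓ + 1)} (h : SF F τ H A) : IsStdFlagB ℓ F := by
  classical
  have hc := h.comb
  let c : Fin ℓ → BKind ℓ := fun i => if H i then kind A (τ i) else .std (τ i)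
  have cH : ∀ i, H i → c i = kind A (τ i) := fun i hi => if_pos hi
  have cN : ∀ i, ¬ H i → c i = .std (τ i) := fun i hi => if_neg hi
  have hA' : (A : ℕ) < ℓ := hc.A_lt
  have hb : ∀ i, bvec ℓ (c i) = svec τ H A i := by
    intro i
    by_cases hi : H i
    · rw [cH i hi, bvec_kind hc.A_lt (hc.ge i hi), svec, if_pos hi]
    · rw [cN i hi, svec, if_neg hi]; rfl
  have hidx : ∀ i, bIndex ℓ (c i) = fold (τ i) := by
    intro i
    by_cases hi : H i
    · rw [cH i hi, bIndex_kind hc.A_lt (hc.ge i hi)]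
    · rw [cN i hi, fold]
  have h1 : ∀ i a, c i = .hat1 a → H i ∧ τ i = A.rev ∧ a = A + 1 := by
    intro i a e
    by_cases hi : H i
    · rw [cH i hi, kind] at e
      split_ifs at e with h'
      · simp only [BKind.hat1.injEq] at e
        exact ⟨hi, h', e.symm⟩
    · rw [cN i hi] at e; simp at e
  have h2 : ∀ i a j, c i = .hat2 a j → H i ∧ τ i ≠ A.rev ∧ a = A + 1 ∧ j = 2 * ℓ + 1 - τ i := by
    intro i a j e
    by_cases hi : H i
    · rw [cH i hi, kind] at e
      split_ifs at e with h'
      · simp only [BKind.hat2.injEq] at e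
        exact ⟨hi, h', e.1.symm, e.2.symm⟩
    · rw [cN i hi] at e; simp at e
  refine ⟨c, ?_, ?_, ?_, ?_, ?_, ?_⟩
  · intro i
    rw [setOf_eq_image (fun k => bvec ℓ (c k)) i, h.span]
    simp only [hb]
  · intro i a e
    obtain ⟨_, _, rfl⟩ := h1 i a e
    omega
  · intro i a j e
    obtain ⟨hi, hne, rfl, rfl⟩ := h2 i a j e
    have := hc.ge i hi
    have h3 : A.rev < τ i := lt_of_le_of_ne this hne.symm
    rw [Fin.lt_def, Fin.val_rev] at h3
    omega
  · intro i k a e hik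
    obtain ⟨hi, he, _⟩ := h1 i a e
    have : ¬ H k := by
      intro hk
      have l1 := hc.dec i k hik hi hk
      rw [he] at l1
      exact absurd (hc.ge k hk) (not_le.2 l1)
    exact ⟨_, cN k this⟩
  · intro i k hik a ji jk e1 e2
    obtain ⟨hi, _, _, rfl⟩ := h2 i a ji e1
    obtain ⟨hk, _, _, rfl⟩ := h2 k a jk e2
    have := Fin.lt_def.1 (hc.dec i k hik hi hk)
    omega
  · refine exists_of_inj (fun i => bIndex ℓ (c i)) ?_ ?_ ?_
    · intro i; simp only [hidx]; exact fold_pos.2 (hc.ne_mid i)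
    · intro i; simp only [hidx]; exact fold_le _
    · intro i j e
      simp only [hidx] at e
      exact hc.inj i j (fold_eq_iff.1 e)

lemma SF.of_isStd (hl : 1 ≤ ℓ) {F : FlagB ℓ} (hF : IsStdFlagB ℓ F) :
    ∃ τ H A, SF F τ H A := by
  classical
  obtain ⟨c, hspan, h1, h2, h3, h4, h5⟩ := hF
  have hex : ∀ i, ∃ (s : Fin (2 * ℓ + 1)) (h : Prop) (A : Fin (2 * ℓ + 1)),
      (¬ h → c i = .std s) ∧ (h → A < mid ℓ ∧ A.rev ≤ s ∧ c i = kind A s) := by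
    intro i
    rcases e : c i with s | a | ⟨a, j⟩
    · exact ⟨s, False, 0, fun _ => rfl, fun h => h.elim⟩
    · obtain ⟨ha1, ha2⟩ := h1 i a e
      let A : Fin (2 * ℓ + 1) := ⟨a - 1, by omega⟩
      refine ⟨A.rev, True, A, fun h => (h trivial).elim, fun _ => ⟨?_, le_rfl, ?_⟩⟩
      · rw [Fin.lt_def]; simp only [A, mid]; omega
      · rw [kind, if_pos rfl]; simp only [A]; congr 1; omega
    · obtain ⟨hj, hja, ha⟩ := h2 i a j e
      let A : Fin (2 * ℓ + 1) := ⟨a - 1, by omega⟩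
      refine ⟨⟨2 * ℓ + 1 - j, by omega⟩, True, A, fun h => (h trivial).elim,
        fun _ => ⟨?_, ?_, ?_⟩⟩
      · rw [Fin.lt_def]; simp only [A, mid]; omega
      · rw [Fin.le_def, Fin.val_rev]; simp only [A]; omega
      · rw [kind, if_neg]
        · simp only [A]; congr 1 <;> omega
        · rw [Fin.ext_iff, Fin.val_rev]; simp only [A]; omega
  choose τ H Af hN hH using hex
  have hidx : ∀ i, bIndex ℓ (c i) = fold (τ i) := by
    intro i
    by_cases hi : H i
    · obtain ⟨x1, x2, x3⟩ := hH i hi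
      rw [x3, bIndex_kind x1 x2]
    · rw [hN i hi, fold]
  have hvec : ∀ i, bvec ℓ (c i) = if H i then hv (Af i) (τ i) else E (τ i) := by
    intro i
    by_cases hi : H i
    · obtain ⟨x1, x2, x3⟩ := hH i hi
      rw [x3, bvec_kind x1 x2, if_pos hi]
    · rw [hN i hi, if_neg hi]; rfl
  have hmem : ∀ i j, i ≤ j → bvec ℓ (c i) ∈ F.V j := by
    intro i j hij
    rw [hspan]
    exact Submodule.subset_span ⟨i, hij, rfl⟩
  have hiso : ∀ i j, bform (2 * ℓ + 1) (bvec ℓ (c i)) (bvec ℓ (c j)) = 0 := by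
    intro i j
    rcases le_total i j with h | h
    · exact F.isot j _ (hmem i j h) _ (hmem j j le_rfl)
    · exact F.isot i _ (hmem i i le_rfl) _ (hmem j i h)
  obtain ⟨b1, b2⟩ := bij_of_unique _ h5
  have hAA : ∀ i j, H i → H j → Af i = Af j := by
    intro i j hi hj
    have := hiso i j
    rw [hvec, hvec, if_pos hi, if_pos hj] at this
    exact hv_pair (hH i hi).1 (hH i hi).2.1 (hH j hj).1 (hH j hj).2.1 this
  have hA : ∃ A : Fin (2 * ℓ + 1), A < mid ℓ ∧ ∀ i, H i → Af i = A := by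
    by_cases hx : ∃ i, H i
    · obtain ⟨i, hi⟩ := hx
      exact ⟨Af i, (hH i hi).1, fun j hj => hAA j i hj hi⟩
    · push Not at hx
      exact ⟨0, by rw [Fin.lt_def]; simp only [mid]; exact hl, fun i hi => (hx i hi).elim⟩
  obtain ⟨A, hAlt, hA⟩ := hA
  have hge : ∀ i, H i → A.rev ≤ τ i := by
    intro i hi
    have := (hH i hi).2.1
    rwa [hA i hi] at this
  have hk : ∀ i, H i → c i = kind A (τ i) := by
    intro i hi
    have := (hH i hi).2.2
    rwa [hA i hi] at this
  have hvec' : ∀ i, bvec ℓ (c i) = svec τ H A i := by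
    intro i
    rw [hvec, svec]
    by_cases hi : H i
    · rw [if_pos hi, if_pos hi, hA i hi]
    · rw [if_neg hi, if_neg hi]
  refine ⟨τ, H, A, ⟨⟨hAlt, ?_, ?_, hge, ?_, ?_⟩, ?_⟩⟩
  · intro i
    rw [← fold_pos, ← hidx]; exact b1 i
  · intro i j e
    apply b2
    simp only [hidx]
    exact fold_eq_iff.2 e
  · intro i j hij hi hj
    have ki := hk i hi
    have kj := hk j hj
    have gi := hge i hi
    have gj := hge j hj
    unfold kind at ki kj
    split_ifs at ki with e1
    · obtain ⟨s, hs⟩ := h3 i j _ ki hij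
      rw [hk j hj] at hs
      exact (kind_ne_std _ _ _ hs).elim
    · split_ifs at kj with e2
      · rw [e2]; exact lt_of_le_of_ne gi (Ne.symm e1)
      · have := h4 i j hij _ _ _ ki kj
        rw [Fin.lt_def]; omega
  · intro i hi
    obtain ⟨q, hq, _⟩ := h5 (fold A) (fold_pos.2 hAlt.ne) (fold_le A)
    have hq' : τ q = A ∨ τ q = A.rev := by
      apply fold_eq_iff.1
      rw [← hidx]; exact hq
    by_cases hHq : H q
    · refine ⟨q, hHq, ?_⟩
      rcases hq' with e | e
      · have := hge q hHq
        rw [e] at this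
        exact absurd (hAlt.trans (mid_lt_rev hAlt)) (not_lt.2 this)
      · exact e
    · have := hiso i q
      rw [hvec', hvec', svec, svec, if_pos hi, if_neg hHq] at this
      exact (bform_hv_E hAlt (hge i hi) hq' this).elim
  · intro i
    rw [hspan, setOf_eq_image (fun k => bvec ℓ (c k)) i]
    simp only [hvec']

end

section
variable {ℓ : ℕ}

lemma fixed_of_support (f : (Fin (2 * ℓ + 1) → ℂ) →ₗ[ℂ] (Fin (2 * ℓ + 1) → ℂ))
    (x : Fin (2 * ℓ + 1) → ℂ) (h : ∀ q, x q ≠ 0 → f (E q) = E q) : f x = x := by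
  rw [map_expand]
  conv_rhs => rw [expand x]
  refine Finset.sum_congr rfl fun q _ => ?_
  by_cases hq : x q = 0
  · simp [hq]
  · rw [h q hq]

lemma mem_of_support (f : (Fin (2 * ℓ + 1) → ℂ) →ₗ[ℂ] (Fin (2 * ℓ + 1) → ℂ))
    (V : Submodule ℂ (Fin (2 * ℓ + 1) → ℂ))
    (x : Fin (2 * ℓ + 1) → ℂ) (h : ∀ q, x q ≠ 0 → f (E q) ∈ V) : f x ∈ V := by
  rw [map_expand]
  refine Submodule.sum_mem _ fun q _ => ?_
  by_cases hq : x q = 0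
  · simp [hq]
  · exact Submodule.smul_mem _ _ (h q hq)

lemma exists_top (x : Fin (2 * ℓ + 1) → ℂ) (h : x ≠ 0) : ∃ p, x p ≠ 0 ∧ ∀ q, p < q → x q = 0 := by
  obtain ⟨q0, hx0⟩ := Function.ne_iff.1 h
  obtain ⟨r, hr, hmax⟩ := (Finset.univ.filter fun q => x q ≠ 0).exists_maximal
    ⟨q0, by simpa using hx0⟩
  refine ⟨r, by simpa using hr, fun q hq => ?_⟩
  by_contra hne
  exact absurd (hmax (by simpa using hne : q ∈ _) hq.le) (not_le.2 hq)

lemma InB.surj {f : (Fin (2 * ℓ + 1) → ℂ) →ₗ[ℂ] (Fin (2 * ℓ + 1) → ℂ)} (hf : InB ℓ f) :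
    Function.Surjective f := LinearMap.injective_iff_surjective.1 hf.inj

lemma exists_new (F : FlagB ℓ) (i : Fin ℓ) : ∃ v ∈ F.V i, v ≠ 0 ∧ ∀ q < i, v ∉ F.V q := by
  by_cases hi : (i : ℕ) = 0
  · have hne : F.V i ≠ ⊥ := by
      intro h
      have := F.dimV i
      rw [h, finrank_bot] at this
      omega
    obtain ⟨v, hv, h0⟩ := Submodule.exists_mem_ne_zero_of_ne_bot hne
    exact ⟨v, hv, h0, fun q hq => by rw [Fin.lt_def] at hq; omega⟩
  · let j : Fin ℓ := ⟨i - 1, by omega⟩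
    have hji : j < i := by rw [Fin.lt_def]; simp only [j]; omega
    have hlt : ¬ F.V i ≤ F.V j := by
      intro h
      have h1 := Submodule.finrank_mono h
      rw [F.dimV, F.dimV] at h1
      simp only [j] at h1
      omega
    obtain ⟨v, hv, hn⟩ := SetLike.not_le_iff_exists.1 hlt
    refine ⟨v, hv, fun h => hn (h ▸ Submodule.zero_mem _), fun q hq hm => hn ?_⟩
    refine F.mono q j ?_ hm
    rw [Fin.le_def]; rw [Fin.lt_def] at hq; simp only [j]; omega

lemma iso2 (F : FlagB ℓ) {i j : Fin ℓ} {u w : Fin (2 * ℓ + 1) → ℂ} (hu : u ∈ F.V i)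
    (hw : w ∈ F.V j) : bform (2 * ℓ + 1) u w = 0 := by
  rcases le_total i j with h | h
  · exact F.isot j _ (F.mono _ _ h hu) _ hw
  · exact F.isot i _ hu _ (F.mono _ _ h hw)

lemma InB.coord_zero {f : (Fin (2 * ℓ + 1) → ℂ) →ₗ[ℂ] (Fin (2 * ℓ + 1) → ℂ)} (hf : InB ℓ f)
    {F : FlagB ℓ} {i j : Fin ℓ} {x : Fin (2 * ℓ + 1) → ℂ} {s : Fin (2 * ℓ + 1)}
    (hx : f x ∈ F.V i) (hs : f (E s) ∈ F.V j) : x s.rev = 0 := by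
  rw [← bform_E_right s x, ← hf.iso]
  exact iso2 F hx hs

/-- Removing coordinates. -/
lemma reduce (F : FlagB ℓ) (f : (Fin (2 * ℓ + 1) → ℂ) →ₗ[ℂ] (Fin (2 * ℓ + 1) → ℂ))
    (k : Fin ℓ) (K : Fin ℓ → Prop) (hK : ∀ i, K i → i < k) (s : Fin ℓ → Fin (2 * ℓ + 1))
    (hs : ∀ i, K i → s i ≠ mid ℓ) (hinj : ∀ i j, K i → K j → s i = s j → i = j)
    (hm : ∀ i, K i → f (E (s i)) ∈ F.V i) (x : Fin (2 * ℓ + 1) → ℂ) (hx : f x ∈ F.V k)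
    (hx0 : f x ≠ 0) (hx1 : ∀ q < k, f x ∉ F.V q) :
    ∃ x', f x' ∈ F.V k ∧ x' ≠ 0 ∧ x' (mid ℓ) = x (mid ℓ) ∧ ∀ i, K i → x' (s i) = 0 := by
  classical
  let y : Fin (2 * ℓ + 1) → ℂ := ∑ q ∈ Finset.univ.filter K, x (s q) • E (s q)
  have hy : ∀ j, (∀ i, K i → i ≤ j) → f y ∈ F.V j := by
    intro j hj
    simp only [y, map_sum, map_smul]
    refine Submodule.sum_mem _ fun q hq => Submodule.smul_mem _ _ ?_
    have hq' : K q := by simpa using hq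
    exact F.mono q j (hj q hq') (hm q hq')
  refine ⟨x - y, ?_, ?_, ?_, ?_⟩
  · rw [map_sub]
    exact Submodule.sub_mem _ hx (hy k fun i hi => (hK i hi).le)
  · rw [sub_ne_zero]
    intro e
    by_cases hk : (k : ℕ) = 0
    · apply hx0
      rw [e]
      have : y = 0 := by
        refine Finset.sum_eq_zero fun q hq => ?_
        have hq' := Fin.lt_def.1 (hK q (by simpa using hq))
        omega
      rw [this, map_zero]
    · have hlt : (⟨k - 1, by omega⟩ : Fin ℓ) < k := by rw [Fin.lt_def]; simp only; omega
      apply hx1 _ hlt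
      rw [e]
      apply hy
      intro i hi
      have := Fin.lt_def.1 (hK i hi)
      rw [Fin.le_def]; simp only; omega
  · have : y (mid ℓ) = 0 := by
      simp only [y, Finset.sum_apply]
      refine Finset.sum_eq_zero fun q hq => ?_
      simp [(hs q (by simpa using hq)).symm]
    simp [this]
  · intro i hi
    have : y (s i) = x (s i) := by
      simp only [y, Finset.sum_apply]
      rw [Finset.sum_eq_single i]
      · simp
      · intro b hb hbi
        have : s i ≠ s b := fun e => hbi (hinj i b hi (by simpa using hb) e).symm
        simp [this]
      · intro hn; simp [hi] at hn
    simp [this]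

lemma bruhat_aux (F : FlagB ℓ) (K : Fin ℓ → Prop)
    (hK : ∀ i, K i → ∃ v ∈ F.V i, v (mid ℓ) = 0 ∧ v ≠ 0 ∧ ∀ q < i, v ∉ F.V q) (n : ℕ) :
    ∃ f, ∃ s : Fin ℓ → Fin (2 * ℓ + 1), InB ℓ f ∧
      (∀ i : Fin ℓ, (i : ℕ) < n → K i → s i ≠ mid ℓ) ∧
      (∀ i j : Fin ℓ, (i : ℕ) < n → (j : ℕ) < n → K i → K j →
        (s i = s j ∨ s i = (s j).rev) → i = j) ∧
      ∀ i : Fin ℓ, (i : ℕ) < n → K i → f (E (s i)) ∈ F.V i := by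
  induction n with
  | zero => exact ⟨LinearMap.id, fun _ => 0, InB.one ℓ, by simp, by simp, by simp⟩
  | succ n ih =>
    obtain ⟨f, s, hf, hs, hinj, hm⟩ := ih
    by_cases hex : ∃ k : Fin ℓ, (k : ℕ) = n ∧ K k
    swap
    · have hh : ∀ i : Fin ℓ, (i : ℕ) < n + 1 → K i → (i : ℕ) < n := by
        intro i hi hKi
        have : (i : ℕ) ≠ n := fun e => hex ⟨i, e, hKi⟩
        omega
      exact ⟨f, s, hf, fun i hi hKi => hs i (hh i hi hKi) hKi,
        fun i j hi hj hKi hKj => hinj i j (hh i hi hKi) (hh j hj hKj) hKi hKj,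
        fun i hi hKi => hm i (hh i hi hKi) hKi⟩
    obtain ⟨k, rfl, hKk⟩ := hex
    obtain ⟨v, hv, hvm, hv0, hv1⟩ := hK k hKk
    obtain ⟨x, rfl⟩ := hf.surj v
    obtain ⟨y, hy, hy0, hym, hys⟩ := reduce F f k (fun i => i < k ∧ K i) (fun i hi => hi.1) s
      (fun i hi => hs i hi.1 hi.2) (fun i j hi hj e => hinj i j hi.1 hj.1 hi.2 hj.2 (Or.inl e))
      (fun i hi => hm i hi.1 hi.2) x hv hv0 hv1
    rw [hf.mid_coord] at hvm
    rw [hvm] at hym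
    obtain ⟨p, hp, hgt⟩ := exists_top y hy0
    have hpm : p ≠ mid ℓ := fun e => hp (e ▸ hym)
    obtain ⟨g, hg, g1, _, g3⟩ := exists_move p y hpm hym
      (by rw [← hf.iso]; exact iso2 F hy hy) hp hgt
    have hrev : ∀ i, i < k → K i → y (s i).rev = 0 := fun i hi hKi =>
      hf.coord_zero hy (hm i hi hKi)
    have n1 : ∀ i, i < k → K i → s i ≠ p := fun i hi hKi e => hp (e ▸ hys i ⟨hi, hKi⟩)
    have n2 : ∀ i, i < k → K i → s i ≠ p.rev := fun i hi hKi e => by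
      have := hrev i hi hKi
      rw [e, Fin.rev_rev] at this
      exact hp this
    have hlt : ∀ i : Fin ℓ, (i : ℕ) < k + 1 → i ≠ k → i < k := by
      intro i hi hne
      have : (i : ℕ) ≠ k := fun e => hne (Fin.ext e)
      rw [Fin.lt_def]; omega
    refine ⟨f ∘ₗ g, Function.update s k p, hf.comp hg, ?_, ?_, ?_⟩
    · intro i hi hKi
      by_cases h : i = k
      · subst h; simpa using hpm
      · rw [Function.update_of_ne h]
        exact hs i (hlt i hi h) hKi
    · intro i j hi hj hKi hKj
      by_cases h : i = k
      · subst h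
        by_cases h' : j = i
        · intro _; exact h'.symm
        · rw [Function.update_of_ne h', Function.update_self]
          rintro (e | e)
          · exact (n1 j (hlt j hj h') hKj e.symm).elim
          · exact (n2 j (hlt j hj h') hKj (by rw [e, Fin.rev_rev])).elim
      · rw [Function.update_of_ne h]
        by_cases h' : j = k
        · subst h'
          rw [Function.update_self]
          rintro (e | e)
          · exact (n1 i (hlt i hi h) hKi e).elim
          · exact (n2 i (hlt i hi h) hKi e).elim
        · rw [Function.update_of_ne h']
          exact hinj i j (hlt i hi h) (hlt j hj h') hKi hKj
    · intro i hi hKi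
      by_cases h : i = k
      · subst h
        rw [Function.update_self, LinearMap.comp_apply, g1]
        exact hy
      · have hik := hlt i hi h
        rw [Function.update_of_ne h, LinearMap.comp_apply,
          g3 _ (n1 i hik hKi) (n2 i hik hKi) (hrev i hik hKi)]
        exact hm i hik hKi

lemma bruhat (F : FlagB ℓ) (K : Fin ℓ → Prop)
    (hK : ∀ i, K i → ∃ v ∈ F.V i, v (mid ℓ) = 0 ∧ v ≠ 0 ∧ ∀ q < i, v ∉ F.V q) :
    ∃ f, ∃ s : Fin ℓ → Fin (2 * ℓ + 1), InB ℓ f ∧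
      (∀ i : Fin ℓ, K i → s i ≠ mid ℓ) ∧
      (∀ i j : Fin ℓ, K i → K j → (s i = s j ∨ s i = (s j).rev) → i = j) ∧
      ∀ i : Fin ℓ, K i → f (E (s i)) ∈ F.V i := by
  obtain ⟨f, s, h1, h2, h3, h4⟩ := bruhat_aux F K hK ℓ
  exact ⟨f, s, h1, fun i => h2 i i.isLt, fun i j => h3 i j i.isLt j.isLt, fun i => h4 i i.isLt⟩

lemma finish (F : FlagB ℓ) {f : (Fin (2 * ℓ + 1) → ℂ) →ₗ[ℂ] (Fin (2 * ℓ + 1) → ℂ)}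
    (hf : InB ℓ f) {τ : Fin ℓ → Fin (2 * ℓ + 1)} {H : Fin ℓ → Prop} {A : Fin (2 * ℓ + 1)}
    (hc : Comb τ H A) (hm : ∀ i, f (svec τ H A i) ∈ F.V i) :
    ∃ F' : FlagB ℓ, SF F' τ H A ∧ ∀ i, (F'.V i).map f = F.V i := by
  have hmap : ∀ i, ((F.V i).comap f).map f = F.V i := fun i =>
    Submodule.map_comap_eq_of_surjective hf.surj _
  have hdim : ∀ i, Module.finrank ℂ ((F.V i).comap f) = (i : ℕ) + 1 := by
    intro i
    rw [← F.dimV i]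
    conv_rhs => rw [← hmap i]
    exact (Submodule.equivMapOfInjective f hf.inj _).finrank_eq
  refine ⟨⟨fun i => (F.V i).comap f, fun i j h => Submodule.comap_mono (F.mono i j h), hdim,
    fun i u hu w hw => ?_⟩, ⟨hc, ?_⟩, hmap⟩
  · rw [← hf.iso]
    exact F.isot i _ hu _ hw
  · intro i
    symm
    apply Submodule.eq_of_le_of_finrank_eq
    · rw [Submodule.span_le]
      rintro _ ⟨q, hq, rfl⟩
      exact F.mono q i hq (hm q)
    · have h := finrank_span_eq_card (hc.linInd.comp (Subtype.val : {q // q ≤ i} → _)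
        Subtype.val_injective)
      rw [hdim, Set.image_eq_range]
      refine h.trans ?_
      rw [Fintype.card_subtype]
      have : (Finset.univ.filter fun q => q ≤ i) = Finset.Iic i := by ext; simp
      rw [this, Fin.card_Iic]
end

section
variable {ℓ : ℕ}

lemma hv_split {A P : Fin (2 * ℓ + 1)} (h : P ≠ A.rev) : hv A P = hv A A.rev + E P := by
  unfold hv
  rw [if_neg h, if_pos rfl, add_zero]

lemma hv_rev (A : Fin (2 * ℓ + 1)) :
    hv A A.rev = E A + (Real.sqrt 2 : ℂ) • E (mid ℓ) - E A.rev := by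
  unfold hv
  rw [if_pos rfl, add_zero]

/-- The state of the reduction of the hat vectors. -/
structure St (F : FlagB ℓ) (A : Fin (2 * ℓ + 1)) (k : Fin ℓ)
    (f : (Fin (2 * ℓ + 1) → ℂ) →ₗ[ℂ] (Fin (2 * ℓ + 1) → ℂ)) (τ : Fin ℓ → Fin (2 * ℓ + 1))
    (H : Fin ℓ → Prop) (Y : Fin (2 * ℓ + 1) → ℂ) : Prop where
  A_lt : A < mid ℓ
  inB : InB ℓ f
  Hk : H k
  Hgt : ∀ i, k < i → ¬ H i
  ne_mid : ∀ i, i ≠ k → τ i ≠ mid ℓ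
  ne_A : ∀ i, i ≠ k → τ i ≠ A
  ne_A' : ∀ i, i ≠ k → τ i ≠ A.rev
  inj : ∀ i j, i ≠ k → j ≠ k → (τ i = τ j ∨ τ i = (τ j).rev) → i = j
  gt : ∀ i, i ≠ k → H i → A.rev < τ i
  dec : ∀ i j, i < j → j ≠ k → H i → H j → τ j < τ i
  mem : ∀ i, i ≠ k → f (svec τ H A i) ∈ F.V i
  memk : f (hv A A.rev + Y) ∈ F.V k
  supp1 : ∀ q, Y q ≠ 0 → A.rev < q
  supp2 : ∀ q, Y q ≠ 0 → ∃ i, k < i ∧ τ i = q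
  top : ∀ q i, Y q ≠ 0 → i ≠ k → H i → q < τ i

lemma St.step {F : FlagB ℓ} {A : Fin (2 * ℓ + 1)} {k : Fin ℓ}
    {f : (Fin (2 * ℓ + 1) → ℂ) →ₗ[ℂ] (Fin (2 * ℓ + 1) → ℂ)} {τ : Fin ℓ → Fin (2 * ℓ + 1)}
    {H : Fin ℓ → Prop} {Y : Fin (2 * ℓ + 1) → ℂ} (h : St F A k f τ H Y) (hY : Y ≠ 0) :
    ∃ k' f' τ' H' Y', k < k' ∧ St F A k' f' τ' H' Y' := by
  classical
  obtain ⟨P, hP, hgt⟩ := exists_top Y hY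
  have hAm := mid_lt_rev h.A_lt
  have hPA := h.supp1 P hP
  have hPm : mid ℓ < P := hAm.trans hPA
  obtain ⟨i0, hi0, hτ0⟩ := h.supp2 P hP
  have low : ∀ q, q ≤ A.rev → Y q = 0 := fun q hq => by
    by_contra hne
    exact absurd (h.supp1 q hne) (not_lt.2 hq)
  have hiso : bform (2 * ℓ + 1) Y Y = 0 := by
    rw [bform_eq]
    refine Finset.sum_eq_zero fun q _ => ?_
    by_cases hq : Y q = 0
    · rw [hq, zero_mul]
    · have h1 : mid ℓ < q := hAm.trans (h.supp1 q hq)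
      have h2 : q.rev < mid ℓ := by rw [← rev_mid, Fin.rev_lt_rev]; exact h1
      rw [low q.rev (h2.trans hAm).le, mul_zero]
  obtain ⟨G, hG, G1, _, G3⟩ := exists_move P Y hPm.ne' (low _ hAm.le) hiso hP hgt
  have hAP : A < P := (h.A_lt.trans hAm).trans hPA
  have GA : G (E A) = E A := by
    refine G3 A hAP.ne (fun e => ?_) (low _ le_rfl)
    rw [e, Fin.rev_rev] at hPA
    exact lt_irrefl _ hPA
  have GA' : G (E A.rev) = E A.rev := by
    refine G3 _ hPA.ne (fun e => ?_) ?_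
    · exact hAP.ne (Fin.rev_injective e)
    · rw [Fin.rev_rev]
      exact low _ (h.A_lt.trans hAm).le
  have Ghv : G (hv A A.rev) = hv A A.rev := by
    rw [hv_rev, map_sub, map_add, map_smul, GA, GA', hG.fix]
  have Gτ : ∀ i, i ≠ k → i ≠ i0 → G (E (τ i)) = E (τ i) := by
    intro i hik hi
    refine G3 _ (fun e => hi ?_) (fun e => hi ?_) ?_
    · exact h.inj i i0 hik hi0.ne' (Or.inl (e.trans hτ0.symm))
    · exact h.inj i i0 hik hi0.ne' (Or.inr (by rw [e, hτ0]))
    · by_contra hne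
      obtain ⟨j, hj, hjq⟩ := h.supp2 _ hne
      have := h.inj j i hj.ne' hik (Or.inr hjq)
      subst this
      exact rev_ne (h.ne_mid j hik) hjq.symm
  let Y' : Fin (2 * ℓ + 1) → ℂ := fun q => if ∃ i, i0 < i ∧ τ i = q then Y q else 0
  have hY' : ∀ q, Y' q ≠ 0 → Y q ≠ 0 ∧ ∃ i, i0 < i ∧ τ i = q := by
    intro q hq
    by_cases hh : ∃ i, i0 < i ∧ τ i = q
    · exact ⟨by simpa only [Y', if_pos hh] using hq, hh⟩
    · exact absurd (if_neg hh) hq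
  have GY' : G Y' = Y' := by
    refine fixed_of_support _ _ fun q hq => ?_
    obtain ⟨_, i, hi, rfl⟩ := hY' q hq
    exact Gτ i (hi0.trans hi).ne' hi.ne'
  have hnotk : k ≠ i0 := hi0.ne
  refine ⟨i0, f ∘ₗ G, Function.update τ k P, fun i => H i ∨ i = i0, Y', hi0, ?_⟩
  refine ⟨h.A_lt, h.inB.comp hG, Or.inr rfl, ?_, ?_, ?_, ?_, ?_, ?_, ?_, ?_, ?_, ?_, ?_, ?_⟩
  · rintro i hi (hH | e)
    · exact h.Hgt i (hi0.trans hi) hH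
    · exact hi.ne' e
  · intro i hi
    by_cases hk : i = k
    · subst hk; rw [Function.update_self]; exact hPm.ne'
    · rw [Function.update_of_ne hk]; exact h.ne_mid i hk
  · intro i hi
    by_cases hk : i = k
    · subst hk; rw [Function.update_self]; exact hAP.ne'
    · rw [Function.update_of_ne hk]; exact h.ne_A i hk
  · intro i hi
    by_cases hk : i = k
    · subst hk; rw [Function.update_self]; exact hPA.ne'
    · rw [Function.update_of_ne hk]; exact h.ne_A' i hk
  · intro i j hi hj
    by_cases hk : i = k
    · subst hk
      rw [Function.update_self]
      by_cases hk' : j = i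
      · intro _; exact hk'.symm
      · rw [Function.update_of_ne hk', ← hτ0]
        intro e
        exact absurd (h.inj i0 j hi0.ne' hk' e).symm hj
    · rw [Function.update_of_ne hk]
      by_cases hk' : j = k
      · subst hk'
        rw [Function.update_self, ← hτ0]
        intro e
        exact absurd (h.inj i i0 hk hi0.ne' e) hi
      · rw [Function.update_of_ne hk']
        exact h.inj i j hk hk'
  · rintro i hi (hH | e)
    · by_cases hk : i = k
      · subst hk; rw [Function.update_self]; exact hPA
      · rw [Function.update_of_ne hk]; exact h.gt i hk hH
    · exact absurd e hi
  · rintro i j hij hj hHi (hHj | e)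
    · have hjk : j ≤ k := not_lt.1 fun hh => h.Hgt j hh hHj
      have hik : i < k := lt_of_lt_of_le hij hjk
      have hHi' : H i := by
        rcases hHi with hHi | e
        · exact hHi
        · exact absurd e (hik.trans hi0).ne
      rw [Function.update_of_ne hik.ne]
      by_cases hk : j = k
      · subst hk; rw [Function.update_self]; exact h.top P i hP hik.ne hHi'
      · rw [Function.update_of_ne hk]; exact h.dec i j hij hk hHi' hHj
    · exact absurd e hj
  · intro i hi
    rw [LinearMap.comp_apply]
    by_cases hk : i = k
    · subst hk
      have : svec (Function.update τ i P) (fun i => H i ∨ i = i0) A i = hv A A.rev + E P := by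
        unfold svec
        rw [if_pos (Or.inl h.Hk), Function.update_self, hv_split hPA.ne']
      rw [this, map_add, Ghv, G1]
      exact h.memk
    · have : svec (Function.update τ k P) (fun i => H i ∨ i = i0) A i = svec τ H A i := by
        unfold svec
        rw [Function.update_of_ne hk]
        simp [hi]
      rw [this]
      have : G (svec τ H A i) = svec τ H A i := by
        unfold svec
        split_ifs
        · rw [hv_split (h.ne_A' i hk), map_add, Ghv, Gτ i hk hi]
        · exact Gτ i hk hi
      rw [this]
      exact h.mem i hk
  · have e : hv A A.rev + Y' = (hv A A.rev + Y) - (Y - Y') := by abel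
    rw [LinearMap.comp_apply, map_add, Ghv, GY', e, map_sub]
    refine Submodule.sub_mem _ (F.mono _ _ hi0.le h.memk) ?_
    refine mem_of_support _ _ _ fun q hq => ?_
    have hn : ¬ ∃ i, i0 < i ∧ τ i = q := by
      intro hh
      apply hq
      simp only [Pi.sub_apply, Y', if_pos hh, sub_self]
    have hYq : Y q ≠ 0 := by
      simpa only [Pi.sub_apply, Y', if_neg hn, sub_zero] using hq
    obtain ⟨i, hi, rfl⟩ := h.supp2 q hYq
    have hii : i ≤ i0 := not_lt.1 fun hh => hn ⟨i, hh, rfl⟩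
    have := h.mem i hi.ne'
    unfold svec at this
    rw [if_neg (h.Hgt i hi)] at this
    exact F.mono _ _ hii this
  · intro q hq
    exact h.supp1 q (hY' q hq).1
  · intro q hq
    obtain ⟨_, i, hi, rfl⟩ := hY' q hq
    exact ⟨i, hi, Function.update_of_ne (hi0.trans hi).ne' _ _⟩
  · rintro q i hq hi (hH | e)
    · obtain ⟨hq1, j, hj, hjq⟩ := hY' q hq
      by_cases hk : i = k
      · subst hk
        rw [Function.update_self]
        refine lt_of_le_of_ne (not_lt.1 fun hh => hq1 (hgt q hh)) fun e => ?_
        exact hj.ne' (h.inj j i0 (hi0.trans hj).ne' hi0.ne' (Or.inl (by rw [hjq, e, hτ0])))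
      · rw [Function.update_of_ne hk]; exact h.top q i hq1 hk hH
    · exact absurd e hi

lemma St.done {F : FlagB ℓ} {A : Fin (2 * ℓ + 1)} {k : Fin ℓ}
    {f : (Fin (2 * ℓ + 1) → ℂ) →ₗ[ℂ] (Fin (2 * ℓ + 1) → ℂ)} {τ : Fin ℓ → Fin (2 * ℓ + 1)}
    {H : Fin ℓ → Prop} (h : St F A k f τ H 0) :
    ∃ f' τ' H', InB ℓ f' ∧ Comb τ' H' A ∧ ∀ i, f' (svec τ' H' A i) ∈ F.V i := by
  classical
  have hAm := mid_lt_rev h.A_lt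
  refine ⟨f, Function.update τ k A.rev, H, h.inB, ⟨h.A_lt, ?_, ?_, ?_, ?_, ?_⟩, ?_⟩
  · intro i
    by_cases hk : i = k
    · subst hk; rw [Function.update_self]; exact hAm.ne'
    · rw [Function.update_of_ne hk]; exact h.ne_mid i hk
  · intro i j
    by_cases hk : i = k
    · subst hk
      rw [Function.update_self]
      by_cases hk' : j = i
      · intro _; exact hk'.symm
      · rw [Function.update_of_ne hk']
        rintro (e | e)
        · exact absurd e.symm (h.ne_A' j hk')
        · exact absurd (Fin.rev_injective e).symm (h.ne_A j hk')
    · rw [Function.update_of_ne hk]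
      by_cases hk' : j = k
      · subst hk'
        rw [Function.update_self, Fin.rev_rev]
        rintro (e | e)
        · exact absurd e (h.ne_A' i hk)
        · exact absurd e (h.ne_A i hk)
      · rw [Function.update_of_ne hk']
        exact h.inj i j hk hk'
  · intro i hi
    by_cases hk : i = k
    · subst hk; rw [Function.update_self]
    · rw [Function.update_of_ne hk]; exact (h.gt i hk hi).le
  · intro i j hij hHi hHj
    have hjk : j ≤ k := not_lt.1 fun hh => h.Hgt j hh hHj
    have hik : i < k := lt_of_lt_of_le hij hjk
    rw [Function.update_of_ne hik.ne]
    by_cases hk : j = k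
    · subst hk; rw [Function.update_self]; exact h.gt i hik.ne hHi
    · rw [Function.update_of_ne hk]; exact h.dec i j hij hk hHi hHj
  · intro i _
    exact ⟨k, h.Hk, Function.update_self _ _ _⟩
  · intro i
    by_cases hk : i = k
    · subst hk
      have : svec (Function.update τ i A.rev) H A i = hv A A.rev + 0 := by
        unfold svec
        rw [if_pos h.Hk, Function.update_self, add_zero]
      rw [this]
      exact h.memk
    · have : svec (Function.update τ k A.rev) H A i = svec τ H A i := by
        unfold svec
        rw [Function.update_of_ne hk]
      rw [this]
      exact h.mem i hk

lemma St.final {F : FlagB ℓ} {A : Fin (2 * ℓ + 1)} (n : ℕ) : ∀ {k : Fin ℓ}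
    {f : (Fin (2 * ℓ + 1) → ℂ) →ₗ[ℂ] (Fin (2 * ℓ + 1) → ℂ)} {τ : Fin ℓ → Fin (2 * ℓ + 1)}
    {H : Fin ℓ → Prop} {Y : Fin (2 * ℓ + 1) → ℂ}, ℓ ≤ (k : ℕ) + n → St F A k f τ H Y →
    ∃ f' τ' H', InB ℓ f' ∧ Comb τ' H' A ∧ ∀ i, f' (svec τ' H' A i) ∈ F.V i := by
  induction n with
  | zero => intro k f τ H Y hk _; have := k.isLt; omega
  | succ n ih =>
    intro k f τ H Y hk h
    by_cases hY : Y = 0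
    · subst hY; exact h.done
    · obtain ⟨k', f', τ', H', Y', hlt, h'⟩ := h.step hY
      rw [Fin.lt_def] at hlt
      exact ih (by omega) h'

lemma missing (g : Fin ℓ → Fin ℓ) (k : Fin ℓ)
    (hg : ∀ i j, i ≠ k → j ≠ k → g i = g j → i = j) :
    ∃ a, (∀ i, i ≠ k → g i ≠ a) ∧ ∀ b, b ≠ a → ∃ i, i ≠ k ∧ g i = b := by
  classical
  have hcard : ((Finset.univ.erase k).image g).card < (Finset.univ : Finset (Fin ℓ)).card := by
    refine lt_of_le_of_lt Finset.card_image_le ?_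
    exact Finset.card_erase_lt_of_mem (Finset.mem_univ k)
  obtain ⟨a, _, ha⟩ := Finset.exists_mem_notMem_of_card_lt_card hcard
  have ha' : ∀ i, i ≠ k → g i ≠ a := by
    intro i hi e
    exact ha (Finset.mem_image.2 ⟨i, by simp [hi], e⟩)
  refine ⟨a, ha', ?_⟩
  have hinj : Function.Injective (Function.update g k a) := by
    intro i j
    by_cases hk : i = k
    · subst hk
      by_cases hk' : j = i
      · intro _; exact hk'.symm
      · rw [Function.update_self, Function.update_of_ne hk']
        intro e; exact absurd e.symm (ha' j hk')
    · by_cases hk' : j = k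
      · subst hk'
        rw [Function.update_self, Function.update_of_ne hk]
        intro e; exact absurd e (ha' i hk)
      · rw [Function.update_of_ne hk, Function.update_of_ne hk']
        exact hg i j hk hk'
  intro b hb
  obtain ⟨i, hi⟩ := Finite.injective_iff_surjective.1 hinj b
  by_cases hk : i = k
  · subst hk
    rw [Function.update_self] at hi
    exact absurd hi.symm hb
  · exact ⟨i, hk, by rwa [Function.update_of_ne hk] at hi⟩

lemma missing_pos (s : Fin ℓ → Fin (2 * ℓ + 1)) (k : Fin ℓ) (hm : ∀ i, i ≠ k → s i ≠ mid ℓ)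
    (hinj : ∀ i j, i ≠ k → j ≠ k → (s i = s j ∨ s i = (s j).rev) → i = j) :
    ∃ A, A < mid ℓ ∧ (∀ i, i ≠ k → s i ≠ A) ∧ (∀ i, i ≠ k → s i ≠ A.rev) ∧
      ∀ q, q ≠ mid ℓ → q ≠ A → q ≠ A.rev → ∃ i, i ≠ k ∧ (q = s i ∨ q = (s i).rev) := by
  have hl : 0 < ℓ := lt_of_le_of_lt (Nat.zero_le _) k.isLt
  have hb : ∀ q : Fin (2 * ℓ + 1), fold q - 1 < ℓ := fun q => by have := fold_le q; omega
  obtain ⟨a, ha, hs⟩ := missing (fun i => ⟨fold (s i) - 1, hb _⟩) k (by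
    intro i j hi hj e
    have e' := Fin.mk.inj_iff.1 e
    have h1 := fold_pos.2 (hm i hi)
    have h2 := fold_pos.2 (hm j hj)
    exact hinj i j hi hj (fold_eq_iff.1 (by omega)))
  have hAl : (a : ℕ) < ℓ := a.isLt
  let A : Fin (2 * ℓ + 1) := ⟨a, by omega⟩
  have hA : A < mid ℓ := hAl
  have hfA : fold A = a + 1 := by
    unfold fold bIndex
    simp only [A]
    rw [if_pos hAl]
  have key : ∀ i, i ≠ k → ¬ (s i = A ∨ s i = A.rev) := by
    intro i hi e
    apply ha i hi
    have := fold_eq_iff.2 e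
    apply Fin.ext
    simp only
    omega
  refine ⟨A, hA, fun i hi e => key i hi (Or.inl e), fun i hi e => key i hi (Or.inr e), ?_⟩
  intro q hqm hqA hqA'
  have h1 := fold_pos.2 hqm
  obtain ⟨i, hi, e⟩ := hs ⟨fold q - 1, hb q⟩ (by
    intro e
    have e' : fold q - 1 = a := congrArg Fin.val e
    rcases fold_eq_iff.1 (show fold q = fold A by omega) with h | h
    · exact hqA h
    · exact hqA' h)
  refine ⟨i, hi, fold_eq_iff.1 ?_⟩
  have e' := Fin.mk.inj_iff.1 e
  have h2 := fold_pos.2 (hm i hi)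
  omega
end
section
variable {ℓ : ℕ}

lemma setup (F : FlagB ℓ) (A : Fin (2 * ℓ + 1)) (k : Fin ℓ)
    (f : (Fin (2 * ℓ + 1) → ℂ) →ₗ[ℂ] (Fin (2 * ℓ + 1) → ℂ)) (hf : InB ℓ f)
    (s : Fin ℓ → Fin (2 * ℓ + 1)) (hA : A < mid ℓ)
    (hsm : ∀ i, i ≠ k → s i ≠ mid ℓ) (hsA : ∀ i, i ≠ k → s i ≠ A)
    (hsA' : ∀ i, i ≠ k → s i ≠ A.rev)
    (hinj : ∀ i j, i ≠ k → j ≠ k → (s i = s j ∨ s i = (s j).rev) → i = j)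
    (hcov : ∀ q, q ≠ mid ℓ → q ≠ A → q ≠ A.rev → ∃ i, i ≠ k ∧ (q = s i ∨ q = (s i).rev))
    (hmem : ∀ i, i ≠ k → f (E (s i)) ∈ F.V i)
    (x : Fin (2 * ℓ + 1) → ℂ) (hx : f x ∈ F.V k) (hxm : x (mid ℓ) = Real.sqrt 2)
    (hxs : ∀ i, i < k → x (s i) = 0) :
    ∃ f' τ' H', InB ℓ f' ∧ Comb τ' H' A ∧ ∀ i, f' (svec τ' H' A i) ∈ F.V i := by
  classical
  have hAm := mid_lt_rev hA
  have hAA := hA.trans hAm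
  have hrev : ∀ i, i ≠ k → x (s i).rev = 0 := fun i hi => hf.coord_zero hx (hmem i hi)
  have hprod : ∀ q, q ≠ mid ℓ → q ≠ A → q ≠ A.rev → x q * x q.rev = 0 := by
    intro q h1 h2 h3
    obtain ⟨i, hi, e | e⟩ := hcov q h1 h2 h3
    · rw [e, hrev i hi, mul_zero]
    · rw [e, hrev i hi, zero_mul]
  have hAx : x A * x A.rev = -1 := by
    have h0 : bform (2 * ℓ + 1) x x = 0 := by rw [← hf.iso]; exact iso2 F hx hx
    rw [bform_eq, ← Finset.sum_subset (Finset.subset_univ ({A, A.rev, mid ℓ} : Finset _))] at h0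
    · rw [Finset.sum_insert (by simp [hAA.ne, hA.ne]), Finset.sum_insert (by simp [hAm.ne']),
        Finset.sum_singleton, Fin.rev_rev, rev_mid, hxm, sqrt2_mul] at h0
      linear_combination h0 / 2
    · intro q _ hq
      simp only [Finset.mem_insert, Finset.mem_singleton, not_or] at hq
      exact hprod q hq.2.2 hq.1 hq.2.1
  have ht : x A ≠ 0 := by
    intro h; rw [h, zero_mul] at hAx; norm_num at hAx
  let y1 : Fin (2 * ℓ + 1) → ℂ := fun q => if q ≤ A then x q else 0
  have y1n : ∀ q, A < q → y1 q = 0 := fun q hq => if_neg (not_le.2 hq)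
  have y1p : ∀ q, q ≤ A → y1 q = x q := fun q hq => if_pos hq
  have y1z : ∀ q, x q = 0 → y1 q = 0 := fun q hq => by simp [y1, hq]
  obtain ⟨g1, hg1, g1A, g1A', g1f⟩ := exists_move A y1 hA.ne (y1n _ hA) (by
    rw [bform_eq]
    refine Finset.sum_eq_zero fun q _ => ?_
    by_cases hq : q ≤ A
    · have h1 : A.rev ≤ q.rev := Fin.rev_le_rev.2 hq
      rw [y1n q.rev (hAA.trans_le h1), mul_zero]
    · rw [y1n q (not_le.1 hq), zero_mul]) (by rw [y1p A le_rfl]; exact ht) y1n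
  rw [y1p A le_rfl] at g1A'
  let z2 : Fin (2 * ℓ + 1) → ℂ :=
    fun q => if A < q ∧ q ≤ A.rev ∧ q ≠ mid ℓ then - x A * x q else 0
  have z2p : ∀ q, A < q → q ≤ A.rev → q ≠ mid ℓ → z2 q = - x A * x q :=
    fun q h1 h2 h3 => if_pos ⟨h1, h2, h3⟩
  have z2m : z2 (mid ℓ) = 0 := if_neg fun h => h.2.2 rfl
  have z2lo : ∀ q, q ≤ A → z2 q = 0 := fun q hq => if_neg fun h => absurd h.1 (not_lt.2 hq)
  have z2hi : ∀ q, A.rev < q → z2 q = 0 := fun q hq => if_neg fun h => absurd h.2.1 (not_le.2 hq)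
  have z2z : ∀ q, x q = 0 → z2 q = 0 := fun q hq => by simp [z2, hq]
  have z2A : z2 A.rev = 1 := by
    rw [z2p _ hAA le_rfl hAm.ne']
    linear_combination - hAx
  obtain ⟨g2, hg2, g2A', g2A, g2f⟩ := exists_move A.rev z2 hAm.ne' z2m (by
    rw [bform_eq]
    refine Finset.sum_eq_zero fun q _ => ?_
    by_cases h1 : q = mid ℓ
    · rw [h1, z2m, zero_mul]
    by_cases h2 : q = A
    · rw [h2, z2lo A le_rfl, zero_mul]
    by_cases h3 : q = A.rev
    · rw [h3, Fin.rev_rev, z2lo A le_rfl, mul_zero]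
    rcases mul_eq_zero.1 (hprod q h1 h2 h3) with h | h
    · rw [z2z q h, zero_mul]
    · rw [z2z _ h, mul_zero]) (by rw [z2A]; exact one_ne_zero) z2hi
  rw [Fin.rev_rev, z2A, inv_one, one_smul] at g2A
  rw [Fin.rev_rev] at g2f
  let Y : Fin (2 * ℓ + 1) → ℂ := fun q => if A.rev < q then x q else 0
  have hY : ∀ q, Y q ≠ 0 → A.rev < q ∧ x q ≠ 0 := by
    intro q hq
    by_cases h : A.rev < q
    · exact ⟨h, by simpa only [Y, if_pos h] using hq⟩
    · exact absurd (if_neg h) hq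
  have gY : ∀ q, Y q ≠ 0 → g1 (E q) = E q ∧ g2 (E q) = E q := by
    intro q hq
    obtain ⟨h1, h2⟩ := hY q hq
    have hqr : q.rev < A := by rw [← Fin.rev_rev A, Fin.rev_lt_rev]; exact h1
    have h3 : x q.rev = 0 :=
      (mul_eq_zero.1 (hprod q (hAm.trans h1).ne' (hAA.trans h1).ne' h1.ne')).resolve_left h2
    exact ⟨g1f q (hAA.trans h1).ne' h1.ne' (y1z _ h3),
      g2f q h1.ne' (hAA.trans h1).ne' (z2z _ h3)⟩
  have gs : ∀ i, i ≠ k → g1 (E (s i)) = E (s i) ∧ g2 (E (s i)) = E (s i) := by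
    intro i hi
    exact ⟨g1f _ (hsA i hi) (hsA' i hi) (y1z _ (hrev i hi)),
      g2f _ (hsA' i hi) (hsA i hi) (z2z _ (hrev i hi))⟩
  have g2y1 : g2 y1 = y1 := by
    refine fixed_of_support _ _ fun q hq => ?_
    have hqA : q ≤ A := not_lt.1 fun hh => hq (y1n q hh)
    rcases hqA.eq_or_lt with e | hlt
    · rw [e]; exact g2A
    · exact g2f q (hlt.trans hAA).ne hlt.ne (z2hi _ (Fin.rev_lt_rev.2 hlt))
  have hgx : g2 (g1 (hv A A.rev + Y)) = x := by
    have e1 : g1 Y = Y := fixed_of_support g1 Y fun q hq => (gY q hq).1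
    have e2 : g2 Y = Y := fixed_of_support g2 Y fun q hq => (gY q hq).2
    simp only [hv_rev, map_add, map_sub, map_smul, g1A, g1A', hg1.fix, e1, g2y1, hg2.fix, g2A', e2]
    funext q
    simp only [Pi.add_apply, Pi.sub_apply, Pi.smul_apply, smul_eq_mul]
    by_cases h1 : q ≤ A
    · have h2 : q < mid ℓ := h1.trans_lt hA
      rw [y1p q h1, z2lo q h1]
      have h3 : Y q = 0 := if_neg (not_lt.2 (h2.trans hAm).le)
      rw [h3]
      simp [h2.ne]
    · have h1' := not_le.1 h1
      rw [y1n q h1']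
      by_cases h2 : q = mid ℓ
      · subst h2
        have h3 : Y (mid ℓ) = 0 := if_neg (not_lt.2 hAm.le)
        rw [z2m, h3, hxm]
        simp
      · by_cases h3 : A.rev < q
        · have h4 : Y q = x q := if_pos h3
          rw [z2hi q h3, h4]
          simp [h2]
        · have h4 : Y q = 0 := if_neg h3
          rw [z2p q h1' (not_lt.1 h3) h2, h4]
          simp [h2]
          field_simp
  refine St.final (F := F) (A := A) (k := k) (f := f ∘ₗ (g2 ∘ₗ g1)) (τ := s) (H := fun i => i = k)
    (Y := Y) ℓ (by omega) ?_
  refine ⟨hA, hf.comp (hg2.comp hg1), rfl, fun i hi => hi.ne', hsm, hsA, hsA', hinj,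
    fun i h1 h2 => absurd h2 h1, fun i j _ h1 _ h2 => absurd h2 h1, ?_, ?_, fun q hq => (hY q hq).1,
    ?_, fun q i _ h1 h2 => absurd h2 h1⟩
  · intro i hi
    have : svec s (fun i => i = k) A i = E (s i) := by
      unfold svec
      rw [if_neg hi]
    rw [this, LinearMap.comp_apply, LinearMap.comp_apply, (gs i hi).1, (gs i hi).2]
    exact hmem i hi
  · rw [LinearMap.comp_apply, LinearMap.comp_apply, hgx]
    exact hx
  · intro q hq
    obtain ⟨h1, h2⟩ := hY q hq
    obtain ⟨i, hi, e | e⟩ := hcov q (hAm.trans h1).ne' (hAA.trans h1).ne' h1.ne'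
    · refine ⟨i, ?_, e.symm⟩
      refine lt_of_le_of_ne (not_lt.1 fun hh => h2 ?_) hi.symm
      rw [e]; exact hxs i hh
    · exact absurd (by rw [e]; exact hrev i hi) h2

lemma existence (hl : 1 ≤ ℓ) (F : FlagB ℓ) :
    ∃ f τ H A, InB ℓ f ∧ Comb τ H A ∧ ∀ i, f (svec τ H A i) ∈ F.V i := by
  classical
  by_cases hall : ∀ i, ∀ v ∈ F.V i, v (mid ℓ) = 0
  · obtain ⟨f, s, hf, hm, hinj, hmem⟩ := bruhat F (fun _ => True) (fun i _ => by
      obtain ⟨v, h1, h2, h3⟩ := exists_new F i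
      exact ⟨v, h1, hall i v h1, h2, h3⟩)
    refine ⟨f, s, fun _ => False, 0, hf, ⟨?_, fun i => hm i trivial,
      fun i j => hinj i j trivial trivial, fun _ h => h.elim, fun _ _ _ h => h.elim,
      fun _ h => h.elim⟩, ?_⟩
    · rw [Fin.lt_def]; simp only [mid, Fin.val_zero]; omega
    · intro i
      have : svec s (fun _ => False) 0 i = E (s i) := by
        unfold svec
        rw [if_neg not_false]
      rw [this]
      exact hmem i trivial
  · have hne : ∃ i, ∃ v ∈ F.V i, v (mid ℓ) ≠ 0 := by
      by_contra hh
      apply hall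
      intro i v hv
      by_contra h0
      exact hh ⟨i, v, hv, h0⟩
    obtain ⟨k, hk, hmin⟩ := (Finset.univ.filter fun i => ∃ v ∈ F.V i, v (mid ℓ) ≠ 0).exists_minimal
      (by obtain ⟨i, hi⟩ := hne; exact ⟨i, by simpa using hi⟩)
    have hk' : ∃ v ∈ F.V k, v (mid ℓ) ≠ 0 := by simpa using hk
    have hlt : ∀ i, i < k → ∀ v ∈ F.V i, v (mid ℓ) = 0 := by
      intro i hi v hv
      by_contra h0
      have hmem : i ∈ Finset.univ.filter fun i => ∃ v ∈ F.V i, v (mid ℓ) ≠ 0 := by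
        simp only [Finset.mem_filter, Finset.mem_univ, true_and]
        exact ⟨v, hv, h0⟩
      exact absurd (hmin hmem hi.le) (not_le.2 hi)
    obtain ⟨w, hw, hw0⟩ := hk'
    obtain ⟨f, s, hf, hm, hinj, hmem⟩ := bruhat F (fun i => i ≠ k) (fun i hik => by
      obtain ⟨v, h1, h2, h3⟩ := exists_new F i
      rcases lt_or_gt_of_ne hik with h | h
      · exact ⟨v, h1, hlt i h v h1, h2, h3⟩
      · have hn : ∀ q < i, v - (v (mid ℓ) / w (mid ℓ)) • w ∉ F.V q := by
          intro q hq hmem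
          have hmax : max q k < i := max_lt hq h
          apply h3 _ hmax
          have e1 := F.mono q _ (le_max_left q k) hmem
          have e2 := F.mono k _ (le_max_right q k) hw
          have := Submodule.add_mem _ e1 (Submodule.smul_mem _ (v (mid ℓ) / w (mid ℓ)) e2)
          rwa [sub_add_cancel] at this
        refine ⟨v - (v (mid ℓ) / w (mid ℓ)) • w, ?_, ?_, ?_, hn⟩
        · exact Submodule.sub_mem _ h1 (Submodule.smul_mem _ _ (F.mono _ _ h.le hw))
        · simp [hw0]
        · intro e
          exact hn k h (by rw [e]; exact Submodule.zero_mem _))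
    obtain ⟨A, hA, hsA, hsA', hcov⟩ := missing_pos s k hm hinj
    obtain ⟨x, hx⟩ := hf.surj (((Real.sqrt 2 : ℂ) / w (mid ℓ)) • w)
    have hxm : x (mid ℓ) = Real.sqrt 2 := by
      rw [← hf.mid_coord x, hx]
      simp [hw0]
    have hfm : f x (mid ℓ) ≠ 0 := by
      rw [hf.mid_coord, hxm]; exact sqrt2_ne
    obtain ⟨y, hy, _, hym, hys⟩ := reduce F f k (fun i => i < k) (fun i hi => hi) s
      (fun i hi => hm i hi.ne) (fun i j hi hj e => hinj i j hi.ne hj.ne (Or.inl e))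
      (fun i hi => hmem i hi.ne) x (by rw [hx]; exact Submodule.smul_mem _ _ hw)
      (fun e => hfm (by rw [e]; rfl)) (fun q hq hmem => hfm (hlt q hq _ hmem))
    obtain ⟨f', τ', H', h1, h2, h3⟩ := setup F A k f hf s hA hm hsA hsA' hinj hcov hmem y hy
      (hym.trans hxm) hys
    exact ⟨f', τ', H', A, h1, h2, h3⟩

end
end StdB

/-- Every maximal isotropic flag in `ℂ^{2ℓ+1}` lies in the
`B_{SO(2ℓ)}`-orbit of a unique `SO(2ℓ+1)`-flag in standard form. -/
theorem statement19 (ℓ : ℕ) (hl : 1 ≤ ℓ) (F : FlagB ℓ) :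
    ∃! F' : FlagB ℓ, IsStdFlagB ℓ F' ∧ flagBRel ℓ F F' := by
  obtain ⟨f, τ, H, A, hf, hc, hm⟩ := StdB.existence hl F
  obtain ⟨F', hF', hmap⟩ := StdB.finish F hf hc hm
  refine ⟨F', ⟨hF'.isStd, ⟨LinearMap.toMatrix' f, hf.toBB, ?_⟩⟩, ?_⟩
  · rw [Matrix.toLin'_toMatrix']
    exact hmap
  · rintro F1 ⟨hstd, g, hg, hg1⟩
    obtain ⟨τ1, H1, A1, h1⟩ := StdB.SF.of_isStd hl hstd
    have hg' := StdB.InB.of_memBB hg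
    refine h1.unique hF' ?_ ?_ ?_
    · intro i; rw [← StdB.invN_rel hg' hg1 i, StdB.invN_rel hf hmap i]
    · intro i; rw [← StdB.invM_rel hg' hg1 i, StdB.invM_rel hf hmap i]
    · intro i; rw [← StdB.invH_rel hg' hg1 i, StdB.invH_rel hf hmap i]

end
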